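/- arXiv:math/0008239 — 2 statements merged into one kernel-verified Lean document; each statement's English description precedes it below -/
import Mathlib

section
/- Let X be an irreducible plane quartic whose singular locus consists of exactly one ordinary cusp and no other singular points. Then X has exactly 10 theta-lines of type 0 (bitangents) and exactly 6 theta-lines of type 1 (lines through the cusp tangent to X), and no theta-lines of type 2. -/
open MvPolynomial

noncomputable section

abbrev P2 : Type := Projectivization ℂ (Fin 3 → ℂ)

/-- The zero locus in `ℙ²` of a polynomial `F`: the points all of whose
representative vectors are zeros of `F`. -/
def curve (F : MvPolynomial (Fin 3) ℂ) : Set P2 :=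
  {p | ∀ (w : Fin 3 → ℂ) (hw : w ≠ 0), Projectivization.mk ℂ w hw = p → eval w F = 0}

/-- The projective line spanned by two vectors. -/
def lineThrough (u v : Fin 3 → ℂ) : Set P2 :=
  {p | ∃ s t : ℂ, ∃ h : s • u + t • v ≠ 0, p = Projectivization.mk ℂ (s • u + t • v) h}

/-- A subset of `ℙ²` is a line if it is the projective span of two
linearly independent vectors. -/
def IsLine (S : Set P2) : Prop :=
  ∃ u v : Fin 3 → ℂ, LinearIndependent ℂ ![u, v] ∧ S = lineThrough u v

/-- The restriction of `F` to the affine parametrization `t ↦ a + t • b` of the line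
through `[a]` and `[b]`, as a polynomial in `t`. -/
def lineRest (F : MvPolynomial (Fin 3) ℂ) (a b : Fin 3 → ℂ) : Polynomial ℂ :=
  eval₂ Polynomial.C (fun i => Polynomial.C (a i) + Polynomial.X * Polynomial.C (b i)) F

/-- The local intersection multiplicity, at the point `[a]`, of the curve `F = 0` with the
line through `[a]` and `[b]` (parametrized by `t ↦ a + t • b`, the point `[a]`
corresponding to `t = 0`). -/
def multAt (F : MvPolynomial (Fin 3) ℂ) (a b : Fin 3 → ℂ) : ℕ :=
  Polynomial.rootMultiplicity 0 (lineRest F a b)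

/-- The scheme `X ∩ L` (for `X = {F = 0}`, `L` a line) is everywhere nonreduced: at each
point of `X ∩ L` the local intersection multiplicity is at least `2`.  (Stated over all
parametrizations of `L`; the base point `a` of a parametrization is a point of `L`, and
every point of `L` occurs as such a base point.) -/
def EverywhereTangent (F : MvPolynomial (Fin 3) ℂ) (S : Set P2) : Prop :=
  ∀ a b : Fin 3 → ℂ, LinearIndependent ℂ ![a, b] → S = lineThrough a b →
    ∀ ha : a ≠ 0, Projectivization.mk ℂ a ha ∈ curve F → 2 ≤ multAt F a b

/-- A theta-line of the quartic `F`: either contained in the curve, or intersecting it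
everywhere nonreducedly. -/
def ThetaLine (F : MvPolynomial (Fin 3) ℂ) (S : Set P2) : Prop :=
  IsLine S ∧ (S ⊆ curve F ∨ EverywhereTangent F S)

/-- A bitangent line of (a smooth curve) `F = 0`: a line, not contained in the curve,
whose scheme-theoretic intersection with the curve is everywhere nonreduced. -/
def Bitangent (F : MvPolynomial (Fin 3) ℂ) (S : Set P2) : Prop :=
  IsLine S ∧ ¬ S ⊆ curve F ∧ EverywhereTangent F S

/-- The line `S` is tangent to the curve `F = 0` at the point `q`: the local intersection
multiplicity there is at least `2`. -/
def TangentAt (F : MvPolynomial (Fin 3) ℂ) (S : Set P2) (q : P2) : Prop :=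
  IsLine S ∧ q ∈ S ∧ q ∈ curve F ∧
    ∀ a b : Fin 3 → ℂ, LinearIndependent ℂ ![a, b] → S = lineThrough a b →
      ∀ ha : a ≠ 0, Projectivization.mk ℂ a ha = q → 2 ≤ multAt F a b

/-- The curve `F = 0` is smooth: `F` and its partial derivatives have no common
projective zero. -/
def SmoothCurve (F : MvPolynomial (Fin 3) ℂ) : Prop :=
  ∀ w : Fin 3 → ℂ, w ≠ 0 → ¬ (eval w F = 0 ∧ ∀ i : Fin 3, eval w (pderiv i F) = 0)

/-- Iterated partial derivative along a list of coordinate directions. -/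
def pderivList (l : List (Fin 3)) (F : MvPolynomial (Fin 3) ℂ) : MvPolynomial (Fin 3) ℂ :=
  l.foldr (fun i G => pderiv i G) F

/-- `F` vanishes to order at least `m` at the point `p` (all partial derivatives of
order `< m` vanish at `p`); i.e. `p` is a point of multiplicity at least `m` of `F = 0`. -/
def VanishesToOrder (F : MvPolynomial (Fin 3) ℂ) (p : P2) (m : ℕ) : Prop :=
  ∀ l : List (Fin 3), l.length < m →
    ∀ (w : Fin 3 → ℂ) (hw : w ≠ 0), Projectivization.mk ℂ w hw = p →
      eval w (pderivList l F) = 0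

/-- `p` is a singular point of the curve `F = 0`. -/
def IsSingularAt (F : MvPolynomial (Fin 3) ℂ) (p : P2) : Prop :=
  VanishesToOrder F p 2

/-- `p` is a double point: a point of multiplicity exactly `2`. -/
def IsDoublePoint (F : MvPolynomial (Fin 3) ℂ) (p : P2) : Prop :=
  VanishesToOrder F p 2 ∧ ¬ VanishesToOrder F p 3

/-- The quadratic form (in the direction `b`) cutting out the tangent cone of `F = 0`
at the double point `[a]`: the degree-`2` Taylor coefficient of `t ↦ F (a + t • b)`. -/
def coneCoeff (F : MvPolynomial (Fin 3) ℂ) (a b : Fin 3 → ℂ) : ℂ :=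
  (lineRest F a b).coeff 2

/-- `p` is an ordinary node: a double point whose tangent cone consists of two distinct
lines, i.e. the tangent-cone quadratic has two null directions independent modulo `a`. -/
def OrdinaryNode (F : MvPolynomial (Fin 3) ℂ) (p : P2) : Prop :=
  IsDoublePoint F p ∧
    ∀ (a : Fin 3 → ℂ) (ha : a ≠ 0), Projectivization.mk ℂ a ha = p →
      ∃ b₁ b₂ : Fin 3 → ℂ, LinearIndependent ℂ ![a, b₁, b₂] ∧
        coneCoeff F a b₁ = 0 ∧ coneCoeff F a b₂ = 0

/-- At the double point `[a]`, the tangent cone is the double line through `[a]` and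
`[b₀]`: `b₀` is a null direction of the tangent-cone quadratic, and every null
direction lies on the line spanned by `a` and `b₀`. -/
def DoubleLineCone (F : MvPolynomial (Fin 3) ℂ) (a b₀ : Fin 3 → ℂ) : Prop :=
  LinearIndependent ℂ ![a, b₀] ∧ coneCoeff F a b₀ = 0 ∧
    ∀ b : Fin 3 → ℂ, coneCoeff F a b = 0 → b ∈ Submodule.span ℂ ({a, b₀} : Set (Fin 3 → ℂ))

/-- `p` is an ordinary cusp: a double point whose tangent cone is a double line `L₀`
with local intersection multiplicity `i(L₀ · X) = 3` at `p`. -/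
def OrdinaryCusp (F : MvPolynomial (Fin 3) ℂ) (p : P2) : Prop :=
  IsDoublePoint F p ∧
    ∀ (a : Fin 3 → ℂ) (ha : a ≠ 0), Projectivization.mk ℂ a ha = p →
      ∃ b₀ : Fin 3 → ℂ, DoubleLineCone F a b₀ ∧ multAt F a b₀ = 3

/-- `p` is an ordinary tacnode: a double point whose tangent cone is a double line `L₀`
with local intersection multiplicity `i(L₀ · X) = 4` at `p`. -/
def OrdinaryTacnode (F : MvPolynomial (Fin 3) ℂ) (p : P2) : Prop :=
  IsDoublePoint F p ∧
    ∀ (a : Fin 3 → ℂ) (ha : a ≠ 0), Projectivization.mk ℂ a ha = p →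
      ∃ b₀ : Fin 3 → ℂ, DoubleLineCone F a b₀ ∧ multAt F a b₀ = 4

/-- A theta-line of type `i`: a theta-line, not a component of the curve, containing
exactly `i` singular points of the curve. -/
def ThetaLineOfType (F : MvPolynomial (Fin 3) ℂ) (i : ℕ) (S : Set P2) : Prop :=
  ThetaLine F S ∧ ¬ S ⊆ curve F ∧ {p | p ∈ S ∧ IsSingularAt F p}.ncard = i

/-- Three points of `ℙ²` are collinear. -/
def Collin (p q r : P2) : Prop :=
  ∃ S : Set P2, IsLine S ∧ p ∈ S ∧ q ∈ S ∧ r ∈ S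


/-- An ordinary bitangent: a bitangent meeting the curve at exactly two distinct points,
each with local intersection multiplicity exactly `2`. -/
def OrdinaryBitangent (F : MvPolynomial (Fin 3) ℂ) (S : Set P2) : Prop :=
  Bitangent F S ∧ (S ∩ curve F).ncard = 2 ∧
    ∀ a b : Fin 3 → ℂ, LinearIndependent ℂ ![a, b] → S = lineThrough a b →
      ∀ ha : a ≠ 0, Projectivization.mk ℂ a ha ∈ curve F → multAt F a b = 2

/-- A bitangent meeting the curve only at smooth points. -/
def SmoothBitangent (F : MvPolynomial (Fin 3) ℂ) (S : Set P2) : Prop :=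
  Bitangent F S ∧ ∀ p ∈ S ∩ curve F, ¬ IsSingularAt F p

theorem isSquare_of_two_le_rootMultiplicity {G : Polynomial ℂ}
    (h4 : G.natDegree ≤ 4) (h3 : G.natDegree ≠ 3)
    (h : ∀ r, G.IsRoot r → 2 ≤ G.rootMultiplicity r) : IsSquare G := by
  classical
  have hcard : G.roots.card = G.natDegree :=
    Polynomial.splits_iff_card_roots.mp (IsAlgClosed.splits G)
  have hsum : ∑ r ∈ G.roots.toFinset, G.roots.count r = G.natDegree := by
    rw [Multiset.toFinset_sum_count_eq, hcard]
  have htwo : ∀ r ∈ G.roots.toFinset, 2 ≤ G.roots.count r := fun r hr => by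
    rw [Polynomial.count_roots]
    exact h r (Polynomial.isRoot_of_mem_roots (Multiset.mem_toFinset.mp hr))
  have heven : ∀ r ∈ G.roots.toFinset, Even (G.roots.count r) := by
    intro r hr
    by_contra hodd
    have h2 := htwo r hr
    rw [← Finset.add_sum_erase _ _ hr] at hsum
    have hne : G.roots.count r ≠ 2 := fun h => hodd (h ▸ even_two)
    have hne' : G.roots.count r ≠ 4 := fun h => hodd (h ▸ by decide)
    have hrest : ∑ s ∈ G.roots.toFinset.erase r, G.roots.count s = 1 := by omega
    obtain ⟨s, hs, hs0⟩ := Finset.exists_ne_zero_of_sum_ne_zero (hrest.trans_ne one_ne_zero)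
    have := Finset.single_le_sum (f := fun s => G.roots.count s) (fun _ _ => Nat.zero_le _) hs
    have := htwo s (Finset.mem_of_mem_erase hs)
    grind
  rw [← Polynomial.C_leadingCoeff_mul_prod_multiset_X_sub_C hcard,
    Polynomial.prod_multiset_root_eq_finset_root]
  refine IsSquare.mul ?_ (Finset.isSquare_prod _ fun r hr => ?_)
  · obtain ⟨z, hz⟩ := IsAlgClosed.exists_pow_nat_eq G.leadingCoeff (n := 2) two_pos
    exact ⟨Polynomial.C z, by rw [← hz, sq, Polynomial.C_mul]⟩
  · rw [← Polynomial.count_roots]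
    exact (heven r hr).isSquare_pow _

theorem ncard_isSquare_sq_sub {q D : Polynomial ℂ} (hq : q.natDegree = 3) (hD : D.natDegree = 6)
    (hroots : D.roots.Nodup) (hqD : (q ^ 2 - D).natDegree ≤ 4) :
    {A : Polynomial ℂ | (A - q).natDegree ≤ 1 ∧ IsSquare (A ^ 2 - D)}.ncard = 10 := by
  classical
  set c := q.coeff 3 with hc
  have hc0 : c ≠ 0 := by
    rw [hc, ← hq, Polynomial.coeff_natDegree, Polynomial.leadingCoeff_ne_zero]
    rintro rfl
    simp at hq
  have hDlead : D.leadingCoeff = c ^ 2 := by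
    have h6 : (q ^ 2 - D).coeff 6 = 0 := Polynomial.coeff_eq_zero_of_natDegree_lt (by omega)
    have h6' : (q ^ 2).coeff 6 = c ^ 2 := by
      have := Polynomial.coeff_pow_of_natDegree_le (p := q) (n := 3) (m := 2) hq.le
      simpa using this
    rw [Polynomial.leadingCoeff, hD]
    rw [Polynomial.coeff_sub, h6'] at h6
    linear_combination -h6
  have hD0 : D ≠ 0 := by
    rintro rfl
    simp at hD
  have hcard : D.roots.card = D.natDegree :=
    Polynomial.splits_iff_card_roots.mp (IsAlgClosed.splits D)
  set R := D.roots.toFinset with hR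
  have hRcard : R.card = 6 := by
    rw [hR, Multiset.toFinset_card_of_nodup hroots, hcard, hD]
  let P : Finset ℂ → Polynomial ℂ := fun S => ∏ r ∈ S, (Polynomial.X - Polynomial.C r)
  have hPmonic : ∀ S, (P S).Monic := fun S => Polynomial.monic_prod_X_sub_C _ _
  have hPdeg : ∀ S, (P S).natDegree = S.card := fun S => by
    rw [Polynomial.natDegree_prod_of_monic _ _ fun r _ => Polynomial.monic_X_sub_C r]
    simp
  have hProot : ∀ S r, (P S).eval r = 0 ↔ r ∈ S := fun S r => by
    simp [P, Polynomial.eval_prod, Finset.prod_eq_zero_iff, sub_eq_zero]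
  have hDP : D = Polynomial.C (c ^ 2) * P R := by
    conv_lhs => rw [← Polynomial.C_leadingCoeff_mul_prod_multiset_X_sub_C hcard, hDlead]
    congr 1
    change _ = (D.roots.toFinset.val.map _).prod
    rw [Multiset.toFinset_val, hroots.dedup]
  obtain ⟨r₀, hr₀⟩ : R.Nonempty := Finset.card_pos.mp (by omega)
  let g : Finset ℂ → Polynomial ℂ := fun T => P (insert r₀ T)
  let h : Finset ℂ → Polynomial ℂ := fun T => P (R \ insert r₀ T)
  let A : Finset ℂ → Polynomial ℂ := fun T => Polynomial.C (c / 2) * (g T + h T)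
  have hsub : ∀ T ∈ (R.erase r₀).powersetCard 2, insert r₀ T ⊆ R ∧ (insert r₀ T).card = 3 ∧
      r₀ ∉ T := by
    intro T hT
    rw [Finset.mem_powersetCard] at hT
    have hr₀T : r₀ ∉ T := fun hmem => by simpa using hT.1 hmem
    exact ⟨Finset.insert_subset hr₀ (hT.1.trans (Finset.erase_subset _ _)),
      by rw [Finset.card_insert_of_notMem hr₀T, hT.2], hr₀T⟩
  have hgh : ∀ T ∈ (R.erase r₀).powersetCard 2, D = Polynomial.C (c ^ 2) * (g T * h T) := by
    intro T hT
    rw [hDP, mul_comm (g T)]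
    congr 1
    exact (Finset.prod_sdiff (hsub T hT).1).symm
  have hsq : ∀ T ∈ (R.erase r₀).powersetCard 2,
      A T ^ 2 - D = (Polynomial.C (c / 2) * (g T - h T)) ^ 2 := by
    intro T hT
    have hcc : Polynomial.C (c ^ 2) = 4 * Polynomial.C (c / 2) ^ 2 := by
      rw [← Polynomial.C_pow, ← Polynomial.C_ofNat, ← Polynomial.C_mul]
      congr 1
      ring
    rw [hgh T hT, hcc]
    simp only [A]
    ring
  have himage : {A : Polynomial ℂ | (A - q).natDegree ≤ 1 ∧ IsSquare (A ^ 2 - D)} =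
      (((R.erase r₀).powersetCard 2).image A : Finset (Polynomial ℂ)) := by
    ext B
    simp only [Set.mem_ofPred_eq, Finset.coe_image, Set.mem_image, Finset.mem_coe]
    constructor
    · rintro ⟨hdeg, E, hE⟩
      have hBq : (B + q).natDegree ≤ 3 := by
        rw [show B + q = (B - q) + Polynomial.C 2 * q by rw [Polynomial.C_ofNat]; ring]
        exact Polynomial.natDegree_add_le_of_degree_le (hdeg.trans (by norm_num))
          ((Polynomial.natDegree_C_mul_le _ _).trans hq.le)
      have hB3 : B.coeff 3 = c := by
        have : (B - q).coeff 3 = 0 := Polynomial.coeff_eq_zero_of_natDegree_lt (by omega)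
        rw [Polynomial.coeff_sub] at this
        linear_combination this
      have hBdeg : B.natDegree ≤ 3 := by
        rw [show B = (B - q) + q by ring]
        exact Polynomial.natDegree_add_le_of_degree_le (hdeg.trans (by norm_num)) hq.le
      have hEdeg : E.natDegree ≤ 2 := by
        have hle : (E ^ 2).natDegree ≤ 4 := by
          rw [show E ^ 2 = (B - q) * (B + q) + (q ^ 2 - D) by linear_combination -hE]
          exact Polynomial.natDegree_add_le_of_degree_le
            (Polynomial.natDegree_mul_le.trans (by omega)) hqD
        rw [Polynomial.natDegree_pow] at hle
        omega
      have hDBE : D = (B - E) * (B + E) := by linear_combination -hE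
      wlog hr : (B - E).eval r₀ = 0 generalizing E
      · refine this (-E) (by rw [hE]; ring) (by rwa [Polynomial.natDegree_neg])
          (by rw [hDBE]; ring) ?_
        have h0 : D.eval r₀ = 0 := by rw [hDP, Polynomial.eval_mul, (hProot R r₀).mpr hr₀, mul_zero]
        rw [hDBE, Polynomial.eval_mul, mul_eq_zero] at h0
        rw [sub_neg_eq_add]
        exact h0.resolve_left hr
      have hE3 : E.coeff 3 = 0 := Polynomial.coeff_eq_zero_of_natDegree_lt (by omega)
      set u := B - E with hu
      have hu3 : u.coeff 3 = c := by rw [hu, Polynomial.coeff_sub, hB3, hE3, sub_zero]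
      have hudeg : u.natDegree = 3 :=
        le_antisymm ((Polynomial.natDegree_sub_le _ _).trans (by omega))
          (Polynomial.le_natDegree_of_ne_zero (hu3.trans_ne hc0))
      have hulead : u.leadingCoeff = c := by rw [Polynomial.leadingCoeff, hudeg, hu3]
      have hurootsle : u.roots ≤ D.roots :=
        Polynomial.roots.le_of_dvd hD0 ⟨_, hDBE⟩
      have hunodup : u.roots.Nodup := Multiset.nodup_of_le hurootsle hroots
      have hucard : u.roots.card = u.natDegree :=
        Polynomial.splits_iff_card_roots.mp (IsAlgClosed.splits u)
      have hScard : u.roots.toFinset.card = 3 := by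
        rw [Multiset.toFinset_card_of_nodup hunodup, hucard, hudeg]
      have hSR : u.roots.toFinset ⊆ R :=
        Multiset.toFinset_subset.mpr (Multiset.subset_of_le hurootsle)
      have huP : u = Polynomial.C c * P u.roots.toFinset := by
        conv_lhs => rw [← Polynomial.C_leadingCoeff_mul_prod_multiset_X_sub_C hucard, hulead]
        congr 1
        change _ = (u.roots.toFinset.val.map _).prod
        rw [Multiset.toFinset_val, hunodup.dedup]
      have hr₀S : r₀ ∈ u.roots.toFinset := by
        rw [← hProot]
        rw [huP, Polynomial.eval_mul, Polynomial.eval_C] at hr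
        exact (mul_eq_zero.mp hr).resolve_left hc0
      generalize u.roots.toFinset = S at *
      have hvP : B + E = Polynomial.C c * P (R \ S) := by
        have hu0 : u ≠ 0 := by
          intro h0
          simp [h0] at hudeg
        apply mul_left_cancel₀ hu0
        have hprod : P (R \ S) * P S = P R := Finset.prod_sdiff hSR
        rw [← hDBE, hDP, ← hprod, huP, Polynomial.C_pow]
        ring
      refine ⟨S.erase r₀, Finset.mem_powersetCard.mpr
        ⟨Finset.erase_subset_erase _ hSR, by rw [Finset.card_erase_of_mem hr₀S, hScard]⟩, ?_⟩
      simp only [A, g, h, Finset.insert_erase hr₀S]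
      have h2 : Polynomial.C (c / 2) * 2 = Polynomial.C c := by
        rw [← Polynomial.C_ofNat, ← Polynomial.C_mul]
        congr 1
        ring
      apply mul_left_cancel₀ (two_ne_zero (α := Polynomial ℂ))
      linear_combination (P S + P (R \ S)) * h2 - huP - hvP - hu
    · rintro ⟨T, hT, rfl⟩
      refine ⟨?_, ⟨_, (hsq T hT).trans (sq _)⟩⟩
      have hgdeg : (g T).natDegree = 3 := by rw [hPdeg, (hsub T hT).2.1]
      have hhdeg : (h T).natDegree = 3 := by
        rw [hPdeg, Finset.card_sdiff_of_subset (hsub T hT).1, (hsub T hT).2.1, hRcard]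
      have hg3 : (g T).coeff 3 = 1 := hgdeg ▸ hPmonic _
      have hh3 : (h T).coeff 3 = 1 := hhdeg ▸ hPmonic _
      have hsubdeg : (g T - h T).natDegree ≤ 2 := by
        rw [Polynomial.natDegree_le_iff_coeff_eq_zero]
        intro N hN
        rcases Nat.eq_or_lt_of_le (Nat.succ_le_of_lt hN) with rfl | hN
        · rw [Polynomial.coeff_sub, hg3, hh3, sub_self]
        · exact Polynomial.coeff_eq_zero_of_natDegree_lt
            ((Polynomial.natDegree_sub_le _ _).trans_lt (by omega))
      have hAq3 : (A T + q).coeff 3 = 2 * c := by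
        simp only [A, Polynomial.coeff_add, Polynomial.coeff_C_mul, hg3, hh3, ← hc]
        ring
      have hAq : 3 ≤ (A T + q).natDegree := Polynomial.le_natDegree_of_ne_zero
        (hAq3.trans_ne (mul_ne_zero two_ne_zero hc0))
      have hmul : ((A T - q) * (A T + q)).natDegree ≤ 4 := by
        rw [show (A T - q) * (A T + q) = (A T ^ 2 - D) - (q ^ 2 - D) by ring, hsq T hT]
        refine (Polynomial.natDegree_sub_le _ _).trans (max_le ?_ hqD)
        refine Polynomial.natDegree_pow_le.trans ?_
        have := (Polynomial.natDegree_C_mul_le (c / 2) (g T - h T)).trans hsubdeg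
        omega
      rcases eq_or_ne (A T - q) 0 with h0 | h0
      · simp [h0]
      · rw [Polynomial.natDegree_mul h0] at hmul
        · omega
        · intro h0'
          simp [h0'] at hAq
  rw [himage, Set.ncard_coe_finset, Finset.card_image_of_injOn, Finset.card_powersetCard,
    Finset.card_erase_of_mem hr₀, hRcard]
  · rfl
  intro T hT T' hT' heq
  rw [Finset.mem_coe] at hT hT'
  have hc2 : Polynomial.C (c / 2) ≠ 0 := by simpa using hc0
  have hadd : g T + h T = g T' + h T' := mul_left_cancel₀ hc2 heq
  have hsqeq : (g T - h T) ^ 2 = (g T' - h T') ^ 2 := by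
    have := (hsq T hT).symm.trans ((congrArg (· ^ 2 - D) heq).trans (hsq T' hT'))
    rw [mul_pow, mul_pow] at this
    exact mul_left_cancel₀ (pow_ne_zero 2 hc2) this
  rcases sq_eq_sq_iff_eq_or_eq_neg.mp hsqeq with hd | hd
  · have hgg : g T = g T' := by
      apply mul_left_cancel₀ (two_ne_zero (α := Polynomial ℂ))
      linear_combination hadd + hd
    have hins : insert r₀ T = insert r₀ T' := by
      ext r
      rw [← hProot, ← hProot]
      exact iff_of_eq (congrArg (fun p : Polynomial ℂ => p.eval r = 0) hgg)
    rw [← Finset.erase_insert (hsub T hT).2.2, hins, Finset.erase_insert (hsub T' hT').2.2]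
  · have hgg : g T = h T' := by
      apply mul_left_cancel₀ (two_ne_zero (α := Polynomial ℂ))
      linear_combination hadd + hd
    have h0 : (h T').eval r₀ = 0 := by
      rw [← hgg]
      exact (hProot _ _).mpr (Finset.mem_insert_self _ _)
    have := (hProot _ _).mp h0
    simp at this

theorem eval_lineRest (F : MvPolynomial (Fin 3) ℂ) (a b : Fin 3 → ℂ) (t : ℂ) :
    (lineRest F a b).eval t = eval (a + t • b) F := by
  unfold lineRest
  rw [← Polynomial.coe_evalRingHom, MvPolynomial.hom_eval₂, ← MvPolynomial.eval₂_id]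
  congr 1
  · ext x
    simp
  · ext i
    simp only [Polynomial.coe_evalRingHom, Polynomial.eval_add,
      Polynomial.eval_C, Polynomial.eval_mul, Polynomial.eval_X, Pi.add_apply, Pi.smul_apply,
      smul_eq_mul]

theorem lineRest_eq_of_eval {F : MvPolynomial (Fin 3) ℂ} {a b : Fin 3 → ℂ} {P : Polynomial ℂ}
    (h : ∀ t : ℂ, eval (a + t • b) F = P.eval t) : lineRest F a b = P :=
  Polynomial.funext fun t => (eval_lineRest F a b t).trans (h t)

theorem coeff_zero_lineRest (F : MvPolynomial (Fin 3) ℂ) (a b : Fin 3 → ℂ) :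
    (lineRest F a b).coeff 0 = eval a F := by
  rw [Polynomial.coeff_zero_eq_eval_zero, eval_lineRest, zero_smul, add_zero]

theorem coeff_one_lineRest (F : MvPolynomial (Fin 3) ℂ) (a b : Fin 3 → ℂ) :
    (lineRest F a b).coeff 1 = ∑ i, b i * eval a (pderiv i F) := by
  induction F using MvPolynomial.induction_on with
  | C r => simp [lineRest]
  | add p q hp hq =>
    have : lineRest (p + q) a b = lineRest p a b + lineRest q a b := eval₂_add _ _
    rw [this, Polynomial.coeff_add, hp, hq, ← Finset.sum_add_distrib]
    simp [mul_add]
  | mul_X p j hp =>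
    have : lineRest (p * X j) a b =
        lineRest p a b * (Polynomial.C (a j) + Polynomial.X * Polynomial.C (b j)) := by
      simp [lineRest]
    rw [this, Polynomial.mul_coeff_one, hp, coeff_zero_lineRest]
    simp [pderiv_X, Pi.single_apply, mul_add, Finset.sum_add_distrib, Finset.sum_mul,
      Polynomial.coeff_X, apply_ite]
    rw [mul_comm (eval a p)]
    congr 1
    exact Finset.sum_congr rfl fun i _ => by ring

theorem eval_smul_of_isHomogeneous {F : MvPolynomial (Fin 3) ℂ} {n : ℕ} (hF : F.IsHomogeneous n)
    (s : ℂ) (x : Fin 3 → ℂ) : eval (s • x) F = s ^ n * eval x F := by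
  rw [eval_eq', eval_eq', Finset.mul_sum]
  refine Finset.sum_congr rfl fun d hd => ?_
  have hdeg : ∑ i, d i = n := by
    rw [← hF (mem_support_iff.mp hd), Finsupp.weight_apply, Finsupp.sum_fintype _ _ (by simp)]
    simp
  simp only [Pi.smul_apply, smul_eq_mul, mul_pow, Finset.prod_mul_distrib,
    Finset.prod_pow_eq_pow_sum, hdeg]
  ring

theorem mk_mem_curve_iff {F : MvPolynomial (Fin 3) ℂ} {n : ℕ} (hF : F.IsHomogeneous n)
    {x : Fin 3 → ℂ} (hx : x ≠ 0) : Projectivization.mk ℂ x hx ∈ curve F ↔ eval x F = 0 := by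
  refine ⟨fun h => h x hx rfl, fun h w hw hwx => ?_⟩
  obtain ⟨s, rfl⟩ := (Projectivization.mk_eq_mk_iff' ℂ _ _ _ _).mp hwx
  rw [eval_smul_of_isHomogeneous hF, h, mul_zero]

theorem mk_mem_lineThrough_iff {u v x : Fin 3 → ℂ} (hx : x ≠ 0) :
    Projectivization.mk ℂ x hx ∈ lineThrough u v ↔ x ∈ Submodule.span ℂ {u, v} := by
  rw [Submodule.mem_span_pair]
  constructor
  · rintro ⟨s, t, h, heq⟩
    obtain ⟨r, rfl⟩ := (Projectivization.mk_eq_mk_iff' ℂ _ _ _ _).mp heq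
    exact ⟨r * s, r * t, by module⟩
  · rintro ⟨s, t, rfl⟩
    exact ⟨s, t, hx, rfl⟩

theorem lineThrough_eq_lineThrough_iff {u v u' v' : Fin 3 → ℂ} :
    lineThrough u v = lineThrough u' v' ↔
      Submodule.span ℂ {u, v} = Submodule.span ℂ {u', v'} := by
  constructor
  · intro h
    ext x
    rcases eq_or_ne x 0 with rfl | hx
    · simp
    · rw [← mk_mem_lineThrough_iff hx, h, mk_mem_lineThrough_iff hx]
  · intro h
    ext q
    induction q using Projectivization.ind with
    | h x hx => rw [mk_mem_lineThrough_iff hx, h, mk_mem_lineThrough_iff hx]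

theorem lineThrough_eq_of_mem_span {u v u' v' : Fin 3 → ℂ} (h' : LinearIndependent ℂ ![u', v'])
    (hu : u' ∈ Submodule.span ℂ {u, v}) (hv : v' ∈ Submodule.span ℂ {u, v}) :
    lineThrough u v = lineThrough u' v' := by
  rw [lineThrough_eq_lineThrough_iff, eq_comm]
  apply Submodule.eq_of_le_of_finrank_le
  · rw [Submodule.span_le]
    rintro x (rfl | rfl)
    exacts [hu, hv]
  · have h2 := finrank_span_eq_card h'
    rw [Matrix.range_cons_cons_empty, Fintype.card_fin] at h2
    rw [h2]
    exact (finrank_span_le_card _).trans (by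
      rw [Set.toFinset_insert, Set.toFinset_singleton]
      exact Finset.card_le_two)

theorem exists_add_smul_mem_span {u v x : Fin 3 → ℂ} (huv : LinearIndependent ℂ ![u, v])
    (hx : x ∉ Submodule.span ℂ {u, v}) (y : Fin 3 → ℂ) :
    ∃ t : ℂ, y + t • x ∈ Submodule.span ℂ {u, v} := by
  have h3 : LinearIndependent ℂ ![x, u, v] := by
    rw [Matrix.vecCons, linearIndependent_finCons, Matrix.range_cons_cons_empty]
    exact ⟨huv, hx⟩
  have htop := h3.span_eq_top_of_card_eq_finrank (by simp)
  have hy : y ∈ Submodule.span ℂ (Set.range ![x, u, v]) := htop ▸ Submodule.mem_top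
  rw [Matrix.range_cons, Matrix.range_cons_cons_empty, Set.singleton_union,
    Submodule.mem_span_insert] at hy
  obtain ⟨t, z, hz, rfl⟩ := hy
  refine ⟨-t, ?_⟩
  convert hz using 1
  module

theorem exists_ternary_coeff {F : MvPolynomial (Fin 3) ℂ} (hF : F.IsHomogeneous 4)
    (a c b : Fin 3 → ℂ) : ∃ r : ℕ → ℕ → ℂ, ∀ w y z : ℂ,
      eval (w • a + y • c + z • b) F =
        ∑ i ∈ Finset.range 5, ∑ j ∈ Finset.range (5 - i),
          r i j * (w ^ i * y ^ j * z ^ (4 - i - j)) := by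
  classical
  let l : Fin 3 → MvPolynomial (Fin 3) ℂ := fun i => C (a i) * X 0 + C (c i) * X 1 + C (b i) * X 2
  have hl : ∀ i, (l i).IsHomogeneous 1 := fun i =>
    (((isHomogeneous_C_mul_X _ _).add (isHomogeneous_C_mul_X _ _)).add (isHomogeneous_C_mul_X _ _))
  have hG : (aeval l F).IsHomogeneous 4 := by simpa using hF.aeval l hl
  have heval : ∀ w y z : ℂ, eval (w • a + y • c + z • b) F = eval ![w, y, z] (aeval l F) := by
    intro w y z
    rw [aeval_def, ← MvPolynomial.eval₂_id, ← MvPolynomial.eval₂_id,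
      ← MvPolynomial.coe_eval₂Hom (RingHom.id ℂ) ![w, y, z], MvPolynomial.hom_eval₂]
    congr 1
    · ext x
      simp
    · ext i
      simp [l]
      ring
  generalize aeval l F = G at hG heval
  let e : (Fin 3 →₀ ℕ) → (_ : ℕ) × ℕ := fun d => ⟨d 0, d 1⟩
  let m : ℕ → ℕ → (Fin 3 →₀ ℕ) := fun i j => Finsupp.equivFunOnFinite.symm ![i, j, 4 - i - j]
  have hdeg : ∀ d ∈ G.support, d 0 + d 1 + d 2 = 4 := fun d hd => by
    have := hG (mem_support_iff.mp hd)
    rw [Finsupp.weight_apply, Finsupp.sum_fintype _ _ (by simp)] at this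
    simpa [Fin.sum_univ_three] using this
  refine ⟨fun i j => coeff (m i j) G, fun w y z => ?_⟩
  rw [heval, eval_eq', Finset.sum_sigma']
  refine Finset.sum_of_injOn e ?_ ?_ ?_ ?_
  · intro d hd d' hd' hdd
    have h0 := hdeg d hd
    have h1 := hdeg d' hd'
    simp only [e, Sigma.mk.injEq, heq_eq_eq] at hdd
    ext i
    fin_cases i
    · exact hdd.1
    · exact hdd.2
    · change d 2 = d' 2
      omega
  · intro d hd
    have h0 := hdeg d hd
    simp only [e, Finset.coe_sigma, Set.mem_sigma_iff, Finset.coe_range, Set.mem_Iio]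
    omega
  · rintro ⟨i, j⟩ hij hnot
    rw [Finset.mem_sigma, Finset.mem_range, Finset.mem_range] at hij
    convert zero_mul _
    rw [← notMem_support_iff]
    refine fun hmem => hnot ⟨m i j, hmem, ?_⟩
    simp [e, m]
  · intro d hd
    have h0 := hdeg d hd
    have hm : m (d 0) (d 1) = d := by
      ext i
      fin_cases i
      · simp [m]
      · simp [m]
      · simp [m]
        omega
    simp only [e, hm, Fin.prod_univ_three]
    simp [show 4 - d 0 - d 1 = d 2 by omega]

/-- The univariate polynomial of degree at most four with the given coefficients. -/
def quarticPoly (g₀ g₁ g₂ g₃ g₄ : ℂ) : Polynomial ℂ :=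
  Polynomial.C g₀ + Polynomial.C g₁ * Polynomial.X + Polynomial.C g₂ * Polynomial.X ^ 2 +
    Polynomial.C g₃ * Polynomial.X ^ 3 + Polynomial.C g₄ * Polynomial.X ^ 4

theorem eval_quarticPoly (g₀ g₁ g₂ g₃ g₄ t : ℂ) :
    (quarticPoly g₀ g₁ g₂ g₃ g₄).eval t = g₀ + g₁ * t + g₂ * t ^ 2 + g₃ * t ^ 3 + g₄ * t ^ 4 := by
  simp [quarticPoly]

theorem coeff_quarticPoly (g₀ g₁ g₂ g₃ g₄ : ℂ) (n : ℕ) :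
    (quarticPoly g₀ g₁ g₂ g₃ g₄).coeff n =
      match n with
      | 0 => g₀ | 1 => g₁ | 2 => g₂ | 3 => g₃ | 4 => g₄ | _ => 0 := by
  rcases n with _ | _ | _ | _ | _ | n <;>
    simp [quarticPoly, Polynomial.coeff_X, Polynomial.coeff_X_pow, Polynomial.coeff_C]

theorem natDegree_quarticPoly_le (g₀ g₁ g₂ g₃ g₄ : ℂ) :
    (quarticPoly g₀ g₁ g₂ g₃ g₄).natDegree ≤ 4 := by
  rw [Polynomial.natDegree_le_iff_coeff_eq_zero]
  intro n hn
  obtain ⟨m, rfl⟩ : ∃ m, n = m + 5 := ⟨n - 5, by omega⟩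
  exact coeff_quarticPoly _ _ _ _ _ _

theorem isSquare_quarticPoly_iff (g₀ g₁ g₂ g₃ g₄ : ℂ) :
    IsSquare (quarticPoly g₀ g₁ g₂ g₃ g₄) ↔ ∃ b₀ b₁ b₂ : ℂ, g₀ = b₀ ^ 2 ∧ g₁ = 2 * b₀ * b₁ ∧
      g₂ = b₁ ^ 2 + 2 * b₀ * b₂ ∧ g₃ = 2 * b₁ * b₂ ∧ g₄ = b₂ ^ 2 := by
  constructor
  · rintro ⟨B, hB⟩
    have hdeg : B.natDegree < 3 := by
      have := natDegree_quarticPoly_le g₀ g₁ g₂ g₃ g₄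
      rw [hB, ← sq, Polynomial.natDegree_pow] at this
      omega
    have hBeq := B.as_sum_range_C_mul_X_pow' hdeg
    simp only [Finset.sum_range_succ, Finset.sum_range_zero, zero_add, pow_zero, mul_one,
      pow_one] at hBeq
    generalize B.coeff 0 = b₀ at hBeq
    generalize B.coeff 1 = b₁ at hBeq
    generalize B.coeff 2 = b₂ at hBeq
    have hsq : quarticPoly g₀ g₁ g₂ g₃ g₄ =
        quarticPoly (b₀ ^ 2) (2 * b₀ * b₁) (b₁ ^ 2 + 2 * b₀ * b₂) (2 * b₁ * b₂) (b₂ ^ 2) := by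
      rw [hB, hBeq]
      apply Polynomial.funext
      intro t
      simp [eval_quarticPoly]
      ring
    have hc := fun n => congrArg (fun p : Polynomial ℂ => p.coeff n) hsq
    simp only [coeff_quarticPoly] at hc
    exact ⟨b₀, b₁, b₂, hc 0, hc 1, hc 2, hc 3, hc 4⟩
  · rintro ⟨b₀, b₁, b₂, rfl, rfl, rfl, rfl, rfl⟩
    refine ⟨Polynomial.C b₀ + Polynomial.C b₁ * Polynomial.X + Polynomial.C b₂ * Polynomial.X ^ 2,
      ?_⟩
    apply Polynomial.funext
    intro t
    simp [eval_quarticPoly]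
    ring

theorem quarticPoly_eq_zero_iff {g₀ g₁ g₂ g₃ g₄ : ℂ} :
    quarticPoly g₀ g₁ g₂ g₃ g₄ = 0 ↔ g₀ = 0 ∧ g₁ = 0 ∧ g₂ = 0 ∧ g₃ = 0 ∧ g₄ = 0 := by
  constructor
  · intro h
    have hc := fun n => congrArg (fun p : Polynomial ℂ => p.coeff n) h
    simp only [coeff_quarticPoly, Polynomial.coeff_zero] at hc
    exact ⟨hc 0, hc 1, hc 2, hc 3, hc 4⟩
  · rintro ⟨rfl, rfl, rfl, rfl, rfl⟩
    simp [quarticPoly]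

theorem lineThrough_subset_curve_iff {F : MvPolynomial (Fin 3) ℂ} {n : ℕ}
    (hF : F.IsHomogeneous n) {u v : Fin 3 → ℂ} (huv : LinearIndependent ℂ ![u, v])
    {g₀ g₁ g₂ g₃ g₄ : ℂ} (hg : ∀ s t : ℂ, eval (s • u + t • v) F =
      g₀ * s ^ 4 + g₁ * s ^ 3 * t + g₂ * s ^ 2 * t ^ 2 + g₃ * s * t ^ 3 + g₄ * t ^ 4) :
    lineThrough u v ⊆ curve F ↔ quarticPoly g₀ g₁ g₂ g₃ g₄ = 0 := by
  constructor
  · intro h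
    apply Polynomial.funext
    intro t
    have hne : (1 : ℂ) • u + t • v ≠ 0 := fun h0 =>
      one_ne_zero (LinearIndependent.pair_iff.mp huv 1 t h0).1
    have := (mk_mem_curve_iff hF hne).mp (h ⟨1, t, hne, rfl⟩)
    rw [hg] at this
    rw [eval_quarticPoly, Polynomial.eval_zero, ← this]
    ring
  · rintro h q ⟨s, t, hne, rfl⟩
    obtain ⟨rfl, rfl, rfl, rfl, rfl⟩ := quarticPoly_eq_zero_iff.mp h
    rw [mk_mem_curve_iff hF hne, hg]
    ring

theorem isSquare_of_everywhereTangent {F : MvPolynomial (Fin 3) ℂ} {n : ℕ}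
    (hF : F.IsHomogeneous n) {u v : Fin 3 → ℂ} (huv : LinearIndependent ℂ ![u, v])
    {g₀ g₁ g₂ g₃ g₄ : ℂ} (hg : ∀ s t : ℂ, eval (s • u + t • v) F =
      g₀ * s ^ 4 + g₁ * s ^ 3 * t + g₂ * s ^ 2 * t ^ 2 + g₃ * s * t ^ 3 + g₄ * t ^ 4)
    (h : EverywhereTangent F (lineThrough u v)) : IsSquare (quarticPoly g₀ g₁ g₂ g₃ g₄) := by
  apply isSquare_of_two_le_rootMultiplicity (natDegree_quarticPoly_le _ _ _ _ _)
  · intro h3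
    have h4 : g₄ = 0 := by
      simpa [coeff_quarticPoly] using Polynomial.coeff_eq_zero_of_natDegree_lt
        (p := quarticPoly g₀ g₁ g₂ g₃ g₄) (n := 4) (by omega)
    have hg3 : g₃ ≠ 0 := by
      have := Polynomial.leadingCoeff_ne_zero.mpr
        (Polynomial.ne_zero_of_natDegree_gt (n := 2) (p := quarticPoly g₀ g₁ g₂ g₃ g₄) (by omega))
      simpa [Polynomial.leadingCoeff, h3, coeff_quarticPoly] using this
    have hrest : lineRest F v u = quarticPoly g₄ g₃ g₂ g₁ g₀ := by
      apply lineRest_eq_of_eval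
      intro t
      have := hg t 1
      rw [one_smul, add_comm] at this
      rw [this, eval_quarticPoly]
      ring
    have hvu : LinearIndependent ℂ ![v, u] := LinearIndependent.pair_symm_iff.mp huv
    have hm := h v u hvu (by rw [lineThrough_eq_lineThrough_iff, Set.pair_comm])
      (hvu.ne_zero 0) ((mk_mem_curve_iff hF _).mpr (by simpa [h4] using hg 0 1))
    rw [multAt, hrest] at hm
    have hdvd := (pow_dvd_pow _ hm).trans (Polynomial.pow_rootMultiplicity_dvd _ _)
    rw [Polynomial.C_0, sub_zero, Polynomial.X_pow_dvd_iff] at hdvd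
    exact hg3 (by simpa [coeff_quarticPoly] using hdvd 1 one_lt_two)
  · intro r hr
    have hrest : lineRest F (u + r • v) v =
        (quarticPoly g₀ g₁ g₂ g₃ g₄).comp (Polynomial.X + Polynomial.C r) := by
      apply lineRest_eq_of_eval
      intro t
      have := hg 1 (r + t)
      rw [show u + r • v + t • v = (1 : ℂ) • u + (r + t) • v by module, this,
        Polynomial.eval_comp, eval_quarticPoly]
      simp only [Polynomial.eval_add, Polynomial.eval_X, Polynomial.eval_C]
      ring
    have hind : LinearIndependent ℂ ![u + r • v, v] := by
      rw [LinearIndependent.pair_iff] at huv ⊢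
      intro s t hst
      have := huv s (s * r + t) (by rw [← hst]; module)
      refine ⟨this.1, ?_⟩
      simpa [this.1] using this.2
    have hmult := h (u + r • v) v hind
      (lineThrough_eq_of_mem_span hind
        (Submodule.mem_span_pair.mpr ⟨1, r, by rw [one_smul]⟩)
        (Submodule.subset_span (by simp))) (hind.ne_zero 0)
      ((mk_mem_curve_iff hF _).mpr (by
        have := hg 1 r
        rw [one_smul] at this
        rw [Polynomial.IsRoot, eval_quarticPoly] at hr
        rw [this, ← hr]
        ring))
    rwa [Polynomial.rootMultiplicity_eq_rootMultiplicity, ← hrest]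

theorem everywhereTangent_of_isSquare {F : MvPolynomial (Fin 3) ℂ} {n : ℕ}
    (hF : F.IsHomogeneous n) {u v : Fin 3 → ℂ}
    {g₀ g₁ g₂ g₃ g₄ : ℂ} (hg : ∀ s t : ℂ, eval (s • u + t • v) F =
      g₀ * s ^ 4 + g₁ * s ^ 3 * t + g₂ * s ^ 2 * t ^ 2 + g₃ * s * t ^ 3 + g₄ * t ^ 4)
    (h0 : quarticPoly g₀ g₁ g₂ g₃ g₄ ≠ 0) (h : IsSquare (quarticPoly g₀ g₁ g₂ g₃ g₄)) :
    EverywhereTangent F (lineThrough u v) := by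
  obtain ⟨b₀, b₁, b₂, rfl, rfl, rfl, rfl, rfl⟩ := (isSquare_quarticPoly_iff _ _ _ _ _).mp h
  intro a' b' hab hline ha hmem
  have hspan := lineThrough_eq_lineThrough_iff.mp hline
  obtain ⟨s, t, rfl⟩ := Submodule.mem_span_pair.mp
    (hspan ▸ Submodule.subset_span (by simp) : a' ∈ Submodule.span ℂ {u, v})
  obtain ⟨s', t', rfl⟩ := Submodule.mem_span_pair.mp
    (hspan ▸ Submodule.subset_span (by simp) : b' ∈ Submodule.span ℂ {u, v})
  set q₀ := b₀ * s ^ 2 + b₁ * s * t + b₂ * t ^ 2 with hq₀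
  set q₁ := 2 * b₀ * s * s' + b₁ * (s * t' + s' * t) + 2 * b₂ * t * t' with hq₁
  set q₂ := b₀ * s' ^ 2 + b₁ * s' * t' + b₂ * t' ^ 2 with hq₂
  have hrest : lineRest F (s • u + t • v) (s' • u + t' • v) =
      (quarticPoly q₀ q₁ q₂ 0 0) ^ 2 := by
    apply lineRest_eq_of_eval
    intro x
    rw [show s • u + t • v + x • (s' • u + t' • v) = (s + x * s') • u + (t + x * t') • v by module,
      hg, Polynomial.eval_pow, eval_quarticPoly]
    ring
  have hq0 : q₀ = 0 := by
    rw [mk_mem_curve_iff hF, hg] at hmem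
    rw [← sq_eq_zero_iff, ← hmem]
    ring
  have hne : lineRest F (s • u + t • v) (s' • u + t' • v) ≠ 0 := by
    intro hz
    rw [hrest, sq_eq_zero_iff] at hz
    obtain ⟨-, h1, h2, -, -⟩ := quarticPoly_eq_zero_iff.mp hz
    have hdet : s * t' - t * s' ≠ 0 := by
      intro hd
      have hpair := LinearIndependent.pair_iff.mp hab
      have ht := hpair t' (-t) (by
        rw [show t' • (s • u + t • v) + -t • (s' • u + t' • v) = (s * t' - t * s') • u by module,
          hd, zero_smul])
      have hs := hpair s' (-s) (by
        rw [show s' • (s • u + t • v) + -s • (s' • u + t' • v) = -(s * t' - t * s') • v by module,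
          hd, neg_zero, zero_smul])
      rw [neg_eq_zero] at ht hs
      exact ha (by rw [ht.2, hs.2, zero_smul, zero_smul, add_zero])
    have hb0 : b₀ = 0 := by
      apply (mul_eq_zero.mp _).resolve_left (pow_ne_zero 2 hdet)
      linear_combination t' ^ 2 * hq0 - t * t' * h1 + t ^ 2 * h2 - t' ^ 2 * hq₀ + t * t' * hq₁ -
        t ^ 2 * hq₂
    have hb2 : b₂ = 0 := by
      apply (mul_eq_zero.mp _).resolve_left (pow_ne_zero 2 hdet)
      linear_combination s' ^ 2 * hq0 - s * s' * h1 + s ^ 2 * h2 - s' ^ 2 * hq₀ + s * s' * hq₁ -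
        s ^ 2 * hq₂
    have hb1 : b₁ = 0 := by
      apply (mul_eq_zero.mp _).resolve_left (pow_ne_zero 2 hdet)
      linear_combination -2 * s' * t' * (hq0 - hq₀) + (s * t' + s' * t) * (h1 - hq₁) -
        2 * s * t * (h2 - hq₂)
    exact h0 (quarticPoly_eq_zero_iff.mpr (by simp [hb0, hb1, hb2]))
  rw [multAt, Polynomial.le_rootMultiplicity_iff hne, hrest, Polynomial.C_0, sub_zero]
  apply pow_dvd_pow_of_dvd
  rw [Polynomial.X_dvd_iff, coeff_quarticPoly]
  exact hq0

theorem isSingularAt_mk {F : MvPolynomial (Fin 3) ℂ} {n : ℕ} (hF : F.IsHomogeneous n)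
    {x : Fin 3 → ℂ} (hx : x ≠ 0) (h0 : eval x F = 0) (h1 : ∀ i, eval x (pderiv i F) = 0) :
    IsSingularAt F (Projectivization.mk ℂ x hx) := by
  intro l hl w hw hwx
  obtain ⟨s, rfl⟩ := (Projectivization.mk_eq_mk_iff' ℂ _ _ _ _).mp hwx
  match l, hl with
  | [], _ => exact (eval_smul_of_isHomogeneous hF s x).trans (by rw [h0, mul_zero])
  | [i], _ => exact (eval_smul_of_isHomogeneous hF.pderiv s x).trans (by rw [h1, mul_zero])

/-- In the frame `a, c, b` the form `F` is that of a quartic with a double point at `[a]`, whose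
tangent cone is the double line through `[a]` and `[b]` and which meets that line with
multiplicity three at `[a]`. -/
structure CuspidalForm (F : MvPolynomial (Fin 3) ℂ) (a c b : Fin 3 → ℂ)
    (k c₀ c₁ c₂ c₃ d₀ d₁ d₂ d₃ d₄ : ℂ) : Prop where
  indep : LinearIndependent ℂ ![a, c, b]
  k_ne : k ≠ 0
  c₃_ne : c₃ ≠ 0
  eval_eq : ∀ w y z : ℂ, eval (w • a + y • c + z • b) F =
    k * w ^ 2 * y ^ 2 + w * (c₀ * y ^ 3 + c₁ * y ^ 2 * z + c₂ * y * z ^ 2 + c₃ * z ^ 3) +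
      (d₀ * y ^ 4 + d₁ * y ^ 3 * z + d₂ * y ^ 2 * z ^ 2 + d₃ * y * z ^ 3 + d₄ * z ^ 4)

theorem OrdinaryCusp.exists_cuspidalForm {F : MvPolynomial (Fin 3) ℂ} (hF : F.IsHomogeneous 4)
    {a : Fin 3 → ℂ} (ha : a ≠ 0) (hp : OrdinaryCusp F (Projectivization.mk ℂ a ha)) :
    ∃ c b k c₀ c₁ c₂ c₃ d₀ d₁ d₂ d₃ d₄, CuspidalForm F a c b k c₀ c₁ c₂ c₃ d₀ d₁ d₂ d₃ d₄ := by
  obtain ⟨⟨hsing, -⟩, hcone⟩ := hp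
  obtain ⟨b, ⟨hab, hb, hnull⟩, hmult⟩ := hcone a ha rfl
  obtain ⟨c, hc⟩ : ∃ c, c ∉ Submodule.span ℂ {a, b} := by
    by_contra! hall
    have htop : Submodule.span ℂ {a, b} = ⊤ := Submodule.eq_top_iff'.mpr hall
    have h2 := finrank_span_eq_card hab
    rw [Matrix.range_cons_cons_empty, htop, finrank_top] at h2
    simp at h2
  have hind : LinearIndependent ℂ ![a, c, b] := by
    have h3 : LinearIndependent ℂ ![c, a, b] := by
      rw [Matrix.vecCons, linearIndependent_finCons, Matrix.range_cons_cons_empty]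
      exact ⟨hab, hc⟩
    rw [LinearIndependent] at h3
    have := LinearIndependent.comp h3 ![1, 0, 2] (by decide)
    convert this using 1
    ext i
    fin_cases i <;> rfl
  obtain ⟨r, hr⟩ := exists_ternary_coeff hF a c b
  simp only [Finset.sum_range_succ, Finset.sum_range_zero, zero_add, Nat.sub_zero, Nat.reduceSub,
    pow_zero, pow_one, mul_one, one_mul] at hr
  have h0 : eval a F = 0 := hsing [] (by simp) a ha rfl
  have h1 : ∀ i, eval a (pderiv i F) = 0 := fun i => hsing [i] (by simp) a ha rfl
  have hrest : ∀ y z : ℂ, lineRest F a (y • c + z • b) =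
      quarticPoly (r 4 0) (r 3 1 * y + r 3 0 * z) (r 2 2 * y ^ 2 + r 2 1 * y * z + r 2 0 * z ^ 2)
        (r 1 3 * y ^ 3 + r 1 2 * y ^ 2 * z + r 1 1 * y * z ^ 2 + r 1 0 * z ^ 3)
        (r 0 4 * y ^ 4 + r 0 3 * y ^ 3 * z + r 0 2 * y ^ 2 * z ^ 2 + r 0 1 * y * z ^ 3 +
          r 0 0 * z ^ 4) := by
    intro y z
    apply lineRest_eq_of_eval
    intro t
    have := hr 1 (t * y) (t * z)
    rw [show a + t • (y • c + z • b) = (1 : ℂ) • a + (t * y) • c + (t * z) • b by module, this,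
      eval_quarticPoly]
    ring
  have hcoeff1 : ∀ y z : ℂ, r 3 1 * y + r 3 0 * z = 0 := by
    intro y z
    have := coeff_one_lineRest F a (y • c + z • b)
    simpa [hrest, coeff_quarticPoly, h1] using this
  have hcoeff2 : ∀ y z : ℂ, coneCoeff F a (y • c + z • b) =
      r 2 2 * y ^ 2 + r 2 1 * y * z + r 2 0 * z ^ 2 := by
    intro y z
    rw [coneCoeff, hrest]
    exact coeff_quarticPoly _ _ _ _ _ 2
  have r40 : r 4 0 = 0 := by
    have h := hr 1 0 0
    simp [h0] at h
    exact h.symm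
  have r31 : r 3 1 = 0 := by simpa using hcoeff1 1 0
  have r30 : r 3 0 = 0 := by simpa using hcoeff1 0 1
  have r20 : r 2 0 = 0 := by
    have := hcoeff2 0 1
    simpa [hb] using this.symm
  have hnull' : ∀ y z : ℂ, r 2 2 * y ^ 2 + r 2 1 * y * z = 0 → y = 0 := by
    intro y z hyz
    by_contra hy
    apply hc
    have hmem := hnull (y • c + z • b) (by rw [hcoeff2, r20]; linear_combination hyz)
    have hbmem : b ∈ Submodule.span ℂ {a, b} := Submodule.subset_span (by simp)
    have := Submodule.sub_mem _ hmem (Submodule.smul_mem _ z hbmem)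
    rw [add_sub_cancel_right] at this
    exact (Submodule.smul_mem_iff _ hy).mp this
  have r22 : r 2 2 ≠ 0 := fun h => one_ne_zero (hnull' 1 0 (by rw [h]; ring))
  have r21 : r 2 1 = 0 := hnull' (r 2 1) (-r 2 2) (by ring)
  have r10 : r 1 0 ≠ 0 := by
    intro h
    have hb' := hrest 0 1
    rw [zero_smul, zero_add, one_smul] at hb'
    have hX : lineRest F a b = Polynomial.C (r 0 0) * Polynomial.X ^ 4 := by
      rw [hb']
      simp [quarticPoly, r40, r30, r20, h]
    rw [multAt] at hmult
    have hne : lineRest F a b ≠ 0 := by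
      intro hz
      simp [hz] at hmult
    have := (Polynomial.le_rootMultiplicity_iff hne (a := 0) (n := 4)).mpr (by
      rw [hX, Polynomial.C_0, sub_zero]
      exact dvd_mul_left _ _)
    omega
  refine ⟨c, b, r 2 2, r 1 3, r 1 2, r 1 1, r 1 0, r 0 4, r 0 3, r 0 2, r 0 1, r 0 0,
    hind, r22, r10, fun w y z => ?_⟩
  rw [hr, r40, r31, r30, r20, r21]
  ring

namespace CuspidalForm

variable {F : MvPolynomial (Fin 3) ℂ} {a c b : Fin 3 → ℂ} {k c₀ c₁ c₂ c₃ d₀ d₁ d₂ d₃ d₄ : ℂ}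

theorem eq_zero (h : CuspidalForm F a c b k c₀ c₁ c₂ c₃ d₀ d₁ d₂ d₃ d₄) {w y z : ℂ}
    (h0 : w • a + y • c + z • b = 0) : w = 0 ∧ y = 0 ∧ z = 0 := by
  have := Fintype.linearIndependent_iff.mp h.indep ![w, y, z]
    (by simpa [Fin.sum_univ_three] using h0)
  exact ⟨this 0, this 1, this 2⟩

theorem exists_eq (h : CuspidalForm F a c b k c₀ c₁ c₂ c₃ d₀ d₁ d₂ d₃ d₄) (x : Fin 3 → ℂ) :
    ∃ w y z : ℂ, w • a + y • c + z • b = x := by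
  have htop := h.indep.span_eq_top_of_card_eq_finrank (by simp)
  have hx : x ∈ Submodule.span ℂ (Set.range ![a, c, b]) := htop ▸ Submodule.mem_top
  rwa [Matrix.range_cons, Matrix.range_cons_cons_empty, Set.singleton_union,
    Submodule.mem_span_triple] at hx

theorem eval_pderiv_eq_zero (h : CuspidalForm F a c b k c₀ c₁ c₂ c₃ d₀ d₁ d₂ d₃ d₄) {x : Fin 3 → ℂ}
    (ha : (lineRest F x a).coeff 1 = 0) (hc : (lineRest F x c).coeff 1 = 0)
    (hb : (lineRest F x b).coeff 1 = 0) (i : Fin 3) : eval x (pderiv i F) = 0 := by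
  obtain ⟨w, y, z, he⟩ := h.exists_eq (Pi.single i 1)
  rw [coeff_one_lineRest] at ha hc hb
  have : eval x (pderiv i F) = ∑ j, (Pi.single i 1 : Fin 3 → ℂ) j * eval x (pderiv j F) := by
    simp [Pi.single_apply]
  rw [this, ← he]
  simp only [Pi.add_apply, Pi.smul_apply, smul_eq_mul, add_mul, mul_assoc, Finset.sum_add_distrib,
    ← Finset.mul_sum, ha, hc, hb, mul_zero, add_zero]

end CuspidalForm

/-- The discriminant of the pencil of lines through the cusp, as a polynomial in the slope. -/
def cuspDiscr (k c₀ c₁ c₂ c₃ d₀ d₁ d₂ d₃ d₄ : ℂ) : Polynomial ℂ :=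
  quarticPoly c₀ c₁ c₂ c₃ 0 ^ 2 - Polynomial.C (4 * k) * quarticPoly d₀ d₁ d₂ d₃ d₄

namespace CuspidalForm

variable {F : MvPolynomial (Fin 3) ℂ} {a c b : Fin 3 → ℂ} {k c₀ c₁ c₂ c₃ d₀ d₁ d₂ d₃ d₄ : ℂ}

theorem natDegree_quarticPoly (h : CuspidalForm F a c b k c₀ c₁ c₂ c₃ d₀ d₁ d₂ d₃ d₄) :
    (quarticPoly c₀ c₁ c₂ c₃ 0).natDegree = 3 := by
  apply le_antisymm
  · rw [Polynomial.natDegree_le_iff_coeff_eq_zero]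
    intro n hn
    rw [coeff_quarticPoly]
    rcases n with _ | _ | _ | _ | _ | n <;> first | omega | rfl
  · exact Polynomial.le_natDegree_of_ne_zero ((coeff_quarticPoly _ _ _ _ _ 3).trans_ne h.c₃_ne)

theorem natDegree_sq_sub_cuspDiscr_le :
    (quarticPoly c₀ c₁ c₂ c₃ 0 ^ 2 - cuspDiscr k c₀ c₁ c₂ c₃ d₀ d₁ d₂ d₃ d₄).natDegree ≤ 4 := by
  rw [cuspDiscr, sub_sub_cancel]
  exact (Polynomial.natDegree_C_mul_le _ _).trans (natDegree_quarticPoly_le _ _ _ _ _)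

theorem natDegree_cuspDiscr (h : CuspidalForm F a c b k c₀ c₁ c₂ c₃ d₀ d₁ d₂ d₃ d₄) :
    (cuspDiscr k c₀ c₁ c₂ c₃ d₀ d₁ d₂ d₃ d₄).natDegree = 6 := by
  have h6 : (quarticPoly c₀ c₁ c₂ c₃ 0 ^ 2).natDegree = 6 := by
    rw [Polynomial.natDegree_pow, h.natDegree_quarticPoly]
  rw [cuspDiscr, Polynomial.natDegree_sub_eq_left_of_natDegree_lt, h6]
  rw [h6]
  exact ((Polynomial.natDegree_C_mul_le _ _).trans (natDegree_quarticPoly_le _ _ _ _ _)).trans_lt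
    (by norm_num)

theorem eval_derivative_cuspDiscr_ne_zero (h : CuspidalForm F a c b k c₀ c₁ c₂ c₃ d₀ d₁ d₂ d₃ d₄)
    (hF : F.IsHomogeneous 4) (ha : a ≠ 0)
    (honly : ∀ q : P2, IsSingularAt F q → q = Projectivization.mk ℂ a ha) {z : ℂ}
    (hz : (cuspDiscr k c₀ c₁ c₂ c₃ d₀ d₁ d₂ d₃ d₄).eval z = 0) :
    (cuspDiscr k c₀ c₁ c₂ c₃ d₀ d₁ d₂ d₃ d₄).derivative.eval z ≠ 0 := by
  intro hz'
  have hk := h.k_ne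
  obtain ⟨w, hw⟩ : ∃ w : ℂ, 2 * k * w + (c₀ + c₁ * z + c₂ * z ^ 2 + c₃ * z ^ 3) = 0 :=
    ⟨-(c₀ + c₁ * z + c₂ * z ^ 2 + c₃ * z ^ 3) / (2 * k), by field_simp; ring⟩
  have hk4 : 4 * k ≠ 0 := mul_ne_zero (by norm_num) hk
  have hD : (c₀ + c₁ * z + c₂ * z ^ 2 + c₃ * z ^ 3) ^ 2 -
      4 * k * (d₀ + d₁ * z + d₂ * z ^ 2 + d₃ * z ^ 3 + d₄ * z ^ 4) = 0 := by
    simpa [cuspDiscr, eval_quarticPoly] using hz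
  have hD' : 2 * (c₀ + c₁ * z + c₂ * z ^ 2 + c₃ * z ^ 3) * (c₁ + 2 * c₂ * z + 3 * c₃ * z ^ 2) -
      4 * k * (d₁ + 2 * d₂ * z + 3 * d₃ * z ^ 2 + 4 * d₄ * z ^ 3) = 0 := by
    rw [← hz']
    simp [cuspDiscr, quarticPoly, Polynomial.derivative_pow]
    ring
  have hf0 : k * w ^ 2 + w * (c₀ + c₁ * z + c₂ * z ^ 2 + c₃ * z ^ 3) +
      (d₀ + d₁ * z + d₂ * z ^ 2 + d₃ * z ^ 3 + d₄ * z ^ 4) = 0 := by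
    apply (mul_eq_zero.mp _).resolve_left hk4
    linear_combination
      (2 * k * w + (c₀ + c₁ * z + c₂ * z ^ 2 + c₃ * z ^ 3)) * hw - hD
  have hfz : w * (c₁ + 2 * c₂ * z + 3 * c₃ * z ^ 2) +
      (d₁ + 2 * d₂ * z + 3 * d₃ * z ^ 2 + 4 * d₄ * z ^ 3) = 0 := by
    apply (mul_eq_zero.mp _).resolve_left hk4
    linear_combination 2 * (c₁ + 2 * c₂ * z + 3 * c₃ * z ^ 2) * hw - hD'
  set x := w • a + (1 : ℂ) • c + z • b with hx
  have hx0 : x ≠ 0 := fun h0 => one_ne_zero (h.eq_zero h0).2.1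
  have hrest_a : lineRest F x a = quarticPoly
      (k * w ^ 2 + w * (c₀ + c₁ * z + c₂ * z ^ 2 + c₃ * z ^ 3) +
        (d₀ + d₁ * z + d₂ * z ^ 2 + d₃ * z ^ 3 + d₄ * z ^ 4))
      (2 * k * w + (c₀ + c₁ * z + c₂ * z ^ 2 + c₃ * z ^ 3)) k 0 0 := by
    apply lineRest_eq_of_eval
    intro t
    rw [show x + t • a = (w + t) • a + (1 : ℂ) • c + z • b by module, h.eval_eq, eval_quarticPoly]
    ring
  have hrest_b : lineRest F x b = quarticPoly
      (k * w ^ 2 + w * (c₀ + c₁ * z + c₂ * z ^ 2 + c₃ * z ^ 3) +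
        (d₀ + d₁ * z + d₂ * z ^ 2 + d₃ * z ^ 3 + d₄ * z ^ 4))
      (w * (c₁ + 2 * c₂ * z + 3 * c₃ * z ^ 2) +
        (d₁ + 2 * d₂ * z + 3 * d₃ * z ^ 2 + 4 * d₄ * z ^ 3))
      (w * (c₂ + 3 * c₃ * z) + (d₂ + 3 * d₃ * z + 6 * d₄ * z ^ 2))
      (w * c₃ + (d₃ + 4 * d₄ * z)) d₄ := by
    apply lineRest_eq_of_eval
    intro t
    rw [show x + t • b = w • a + (1 : ℂ) • c + (z + t) • b by module, h.eval_eq, eval_quarticPoly]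
    ring
  have hrest_c : lineRest F x c = quarticPoly
      (k * w ^ 2 + w * (c₀ + c₁ * z + c₂ * z ^ 2 + c₃ * z ^ 3) +
        (d₀ + d₁ * z + d₂ * z ^ 2 + d₃ * z ^ 3 + d₄ * z ^ 4))
      (2 * k * w ^ 2 + w * (3 * c₀ + 2 * c₁ * z + c₂ * z ^ 2) +
        (4 * d₀ + 3 * d₁ * z + 2 * d₂ * z ^ 2 + d₃ * z ^ 3))
      (k * w ^ 2 + w * (3 * c₀ + c₁ * z) + (6 * d₀ + 3 * d₁ * z + d₂ * z ^ 2))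
      (w * c₀ + (4 * d₀ + d₁ * z)) d₀ := by
    apply lineRest_eq_of_eval
    intro t
    rw [show x + t • c = w • a + (1 + t) • c + z • b by module, h.eval_eq, eval_quarticPoly]
    ring
  have hfy : 2 * k * w ^ 2 + w * (3 * c₀ + 2 * c₁ * z + c₂ * z ^ 2) +
      (4 * d₀ + 3 * d₁ * z + 2 * d₂ * z ^ 2 + d₃ * z ^ 3) = 0 := by
    linear_combination 4 * hf0 - w * hw - z * hfz
  have hsing : IsSingularAt F (Projectivization.mk ℂ x hx0) := by
    apply isSingularAt_mk hF hx0
    · rw [← coeff_zero_lineRest F x a, hrest_a, coeff_quarticPoly]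
      exact hf0
    · apply h.eval_pderiv_eq_zero
      · rw [hrest_a, coeff_quarticPoly]
        exact hw
      · rw [hrest_c, coeff_quarticPoly]
        exact hfy
      · rw [hrest_b, coeff_quarticPoly]
        exact hfz
  obtain ⟨s, hs⟩ := (Projectivization.mk_eq_mk_iff' ℂ _ _ _ _).mp (honly _ hsing)
  have := h.eq_zero (w := w - s) (y := 1) (z := z) (by
    rw [sub_smul, hs, hx]
    module)
  exact one_ne_zero this.2.1

theorem nodup_roots_cuspDiscr (h : CuspidalForm F a c b k c₀ c₁ c₂ c₃ d₀ d₁ d₂ d₃ d₄)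
    (hF : F.IsHomogeneous 4) (ha : a ≠ 0)
    (honly : ∀ q : P2, IsSingularAt F q → q = Projectivization.mk ℂ a ha) :
    (cuspDiscr k c₀ c₁ c₂ c₃ d₀ d₁ d₂ d₃ d₄).roots.Nodup := by
  classical
  have hD0 : cuspDiscr k c₀ c₁ c₂ c₃ d₀ d₁ d₂ d₃ d₄ ≠ 0 :=
    Polynomial.ne_zero_of_natDegree_gt (h.natDegree_cuspDiscr ▸ (by norm_num : 0 < 6))
  rw [Multiset.nodup_iff_count_le_one]
  intro z
  by_contra! hz
  rw [Polynomial.count_roots, Polynomial.one_lt_rootMultiplicity_iff_isRoot hD0] at hz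
  exact h.eval_derivative_cuspDiscr_ne_zero hF ha honly hz.1 hz.2

theorem linearIndependent_pencil (h : CuspidalForm F a c b k c₀ c₁ c₂ c₃ d₀ d₁ d₂ d₃ d₄) (z : ℂ) :
    LinearIndependent ℂ ![a, c + z • b] := by
  rw [LinearIndependent.pair_iff]
  intro s t hst
  have := h.eq_zero (w := s) (y := t) (z := t * z) (by rw [← hst]; module)
  exact ⟨this.1, this.2.1⟩

theorem linearIndependent_tangent (h : CuspidalForm F a c b k c₀ c₁ c₂ c₃ d₀ d₁ d₂ d₃ d₄) :
    LinearIndependent ℂ ![a, b] := by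
  rw [LinearIndependent.pair_iff]
  intro s t hst
  have := h.eq_zero (w := s) (y := 0) (z := t) (by rw [← hst]; module)
  exact ⟨this.1, this.2.2⟩

theorem linearIndependent_graph (h : CuspidalForm F a c b k c₀ c₁ c₂ c₃ d₀ d₁ d₂ d₃ d₄)
    (α β : ℂ) : LinearIndependent ℂ ![c + α • a, b + β • a] := by
  rw [LinearIndependent.pair_iff]
  intro s t hst
  have := h.eq_zero (w := s * α + t * β) (y := s) (z := t) (by rw [← hst]; module)
  exact this.2

theorem pencil_injective (h : CuspidalForm F a c b k c₀ c₁ c₂ c₃ d₀ d₁ d₂ d₃ d₄) :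
    Function.Injective fun z : ℂ => lineThrough a (c + z • b) := by
  intro z z' hzz
  have hmem : c + z' • b ∈ Submodule.span ℂ {a, c + z • b} := by
    rw [lineThrough_eq_lineThrough_iff.mp hzz]
    exact Submodule.subset_span (by simp)
  obtain ⟨s, t, hst⟩ := Submodule.mem_span_pair.mp hmem
  have := h.eq_zero (w := s) (y := t - 1) (z := t * z - z') (by
    rw [← sub_eq_zero] at hst
    rw [← hst]
    module)
  have ht : t = 1 := sub_eq_zero.mp this.2.1
  linear_combination this.2.2 - z * ht

theorem graph_injective (h : CuspidalForm F a c b k c₀ c₁ c₂ c₃ d₀ d₁ d₂ d₃ d₄)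
    {α β α' β' : ℂ}
    (heq : lineThrough (c + α • a) (b + β • a) = lineThrough (c + α' • a) (b + β' • a)) :
    α = α' ∧ β = β' := by
  have hspan := lineThrough_eq_lineThrough_iff.mp heq
  obtain ⟨s, t, hst⟩ := Submodule.mem_span_pair.mp
    (hspan ▸ Submodule.subset_span (by simp) :
      c + α' • a ∈ Submodule.span ℂ {c + α • a, b + β • a})
  obtain ⟨s', t', hst'⟩ := Submodule.mem_span_pair.mp
    (hspan ▸ Submodule.subset_span (by simp) :
      b + β' • a ∈ Submodule.span ℂ {c + α • a, b + β • a})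
  rw [← sub_eq_zero] at hst hst'
  have h1 := h.eq_zero (w := s * α + t * β - α') (y := s - 1) (z := t) (by rw [← hst]; module)
  have h2 := h.eq_zero (w := s' * α + t' * β - β') (y := s') (z := t' - 1)
    (by rw [← hst']; module)
  constructor
  · linear_combination h1.1 - α * h1.2.1 - β * h1.2.2
  · linear_combination h2.1 - α * h2.2.1 - β * h2.2.2

theorem eq_tangent_or_exists_pencil_of_mem
    (h : CuspidalForm F a c b k c₀ c₁ c₂ c₃ d₀ d₁ d₂ d₃ d₄) (ha : a ≠ 0) {S : Set P2}
    (hS : IsLine S) (haS : Projectivization.mk ℂ a ha ∈ S) :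
    S = lineThrough a b ∨ ∃ z : ℂ, S = lineThrough a (c + z • b) := by
  obtain ⟨u, v, huv, rfl⟩ := hS
  rw [mk_mem_lineThrough_iff] at haS
  by_cases hb : b ∈ Submodule.span ℂ {u, v}
  · exact Or.inl (lineThrough_eq_of_mem_span h.linearIndependent_tangent haS hb)
  · obtain ⟨z, hz⟩ := exists_add_smul_mem_span huv hb c
    exact Or.inr ⟨z, lineThrough_eq_of_mem_span (h.linearIndependent_pencil z) haS hz⟩

theorem exists_graph_of_notMem
    (h : CuspidalForm F a c b k c₀ c₁ c₂ c₃ d₀ d₁ d₂ d₃ d₄) (ha : a ≠ 0) {S : Set P2}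
    (hS : IsLine S) (haS : Projectivization.mk ℂ a ha ∉ S) :
    ∃ α β : ℂ, S = lineThrough (c + α • a) (b + β • a) := by
  obtain ⟨u, v, huv, rfl⟩ := hS
  rw [mk_mem_lineThrough_iff] at haS
  obtain ⟨α, hα⟩ := exists_add_smul_mem_span huv haS c
  obtain ⟨β, hβ⟩ := exists_add_smul_mem_span huv haS b
  exact ⟨α, β, lineThrough_eq_of_mem_span (h.linearIndependent_graph α β) hα hβ⟩

theorem mk_notMem_graph (h : CuspidalForm F a c b k c₀ c₁ c₂ c₃ d₀ d₁ d₂ d₃ d₄) (ha : a ≠ 0)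
    (α β : ℂ) : Projectivization.mk ℂ a ha ∉ lineThrough (c + α • a) (b + β • a) := by
  rw [mk_mem_lineThrough_iff, Submodule.mem_span_pair]
  rintro ⟨s, t, hst⟩
  rw [← sub_eq_zero] at hst
  have := h.eq_zero (w := s * α + t * β - 1) (y := s) (z := t) (by rw [← hst]; module)
  simp [this.2.1, this.2.2] at this

theorem bitangent_pencil_iff (h : CuspidalForm F a c b k c₀ c₁ c₂ c₃ d₀ d₁ d₂ d₃ d₄)
    (hF : F.IsHomogeneous 4) (z : ℂ) : Bitangent F (lineThrough a (c + z • b)) ↔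
      (cuspDiscr k c₀ c₁ c₂ c₃ d₀ d₁ d₂ d₃ d₄).eval z = 0 := by
  have hk := h.k_ne
  have hind := h.linearIndependent_pencil z
  have hg : ∀ s t : ℂ, eval (s • a + t • (c + z • b)) F =
      0 * s ^ 4 + 0 * s ^ 3 * t + k * s ^ 2 * t ^ 2 +
        (c₀ + c₁ * z + c₂ * z ^ 2 + c₃ * z ^ 3) * s * t ^ 3 +
        (d₀ + d₁ * z + d₂ * z ^ 2 + d₃ * z ^ 3 + d₄ * z ^ 4) * t ^ 4 := by
    intro s t
    rw [show s • a + t • (c + z • b) = s • a + t • c + (t * z) • b by module, h.eval_eq]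
    ring
  have hne : quarticPoly 0 0 k (c₀ + c₁ * z + c₂ * z ^ 2 + c₃ * z ^ 3)
      (d₀ + d₁ * z + d₂ * z ^ 2 + d₃ * z ^ 3 + d₄ * z ^ 4) ≠ 0 :=
    fun h0 => hk (quarticPoly_eq_zero_iff.mp h0).2.2.1
  have hD : (cuspDiscr k c₀ c₁ c₂ c₃ d₀ d₁ d₂ d₃ d₄).eval z =
      (c₀ + c₁ * z + c₂ * z ^ 2 + c₃ * z ^ 3) ^ 2 -
        4 * k * (d₀ + d₁ * z + d₂ * z ^ 2 + d₃ * z ^ 3 + d₄ * z ^ 4) := by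
    simp [cuspDiscr, eval_quarticPoly]
  rw [hD]
  constructor
  · rintro ⟨-, -, ht⟩
    obtain ⟨b₀, b₁, b₂, hb₀, -, hb₂, hb₃, hb₄⟩ :=
      (isSquare_quarticPoly_iff _ _ _ _ _).mp (isSquare_of_everywhereTangent hF hind hg ht)
    have hb₀ : b₀ = 0 := sq_eq_zero_iff.mp hb₀.symm
    rw [hb₃, hb₄, hb₂, hb₀]
    ring
  · intro h0
    refine ⟨⟨_, _, hind, rfl⟩, fun hsub =>
      hne ((lineThrough_subset_curve_iff hF hind hg).mp hsub),
      everywhereTangent_of_isSquare hF hg hne ((isSquare_quarticPoly_iff _ _ _ _ _).mpr ?_)⟩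
    obtain ⟨e, he⟩ := IsAlgClosed.exists_pow_nat_eq k (n := 2) two_pos
    have he0 : e ≠ 0 := by
      rintro rfl
      exact hk (by rw [← he]; ring)
    refine ⟨0, e, (c₀ + c₁ * z + c₂ * z ^ 2 + c₃ * z ^ 3) / (2 * e), by ring, by ring,
      by rw [he]; ring, by field_simp, ?_⟩
    rw [← he] at h0
    field_simp
    linear_combination -h0

theorem not_bitangent_tangent (h : CuspidalForm F a c b k c₀ c₁ c₂ c₃ d₀ d₁ d₂ d₃ d₄)
    (hF : F.IsHomogeneous 4) : ¬ Bitangent F (lineThrough a b) := by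
  rintro ⟨-, -, ht⟩
  have hg : ∀ s t : ℂ, eval (s • a + t • b) F =
      0 * s ^ 4 + 0 * s ^ 3 * t + 0 * s ^ 2 * t ^ 2 + c₃ * s * t ^ 3 + d₄ * t ^ 4 := by
    intro s t
    rw [show s • a + t • b = s • a + (0 : ℂ) • c + t • b by module, h.eval_eq]
    ring
  obtain ⟨b₀, b₁, b₂, hb₀, -, hb₂, hb₃, hb₄⟩ := (isSquare_quarticPoly_iff _ _ _ _ _).mp
    (isSquare_of_everywhereTangent hF h.linearIndependent_tangent hg ht)
  have hb₀ : b₀ = 0 := sq_eq_zero_iff.mp hb₀.symm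
  have hb₁ : b₁ = 0 := sq_eq_zero_iff.mp (by rw [hb₂, hb₀]; ring)
  exact h.c₃_ne (by rw [hb₃, hb₁]; ring)

theorem bitangent_graph_iff (h : CuspidalForm F a c b k c₀ c₁ c₂ c₃ d₀ d₁ d₂ d₃ d₄)
    (hF : F.IsHomogeneous 4) (ha : a ≠ 0)
    (honly : ∀ q : P2, IsSingularAt F q → q = Projectivization.mk ℂ a ha) (α β : ℂ) :
    Bitangent F (lineThrough (c + α • a) (b + β • a)) ↔
      IsSquare (quarticPoly (c₀ + 2 * k * α) (c₁ + 2 * k * β) c₂ c₃ 0 ^ 2 -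
        cuspDiscr k c₀ c₁ c₂ c₃ d₀ d₁ d₂ d₃ d₄) := by
  have hk := h.k_ne
  have hind := h.linearIndependent_graph α β
  set A := quarticPoly (c₀ + 2 * k * α) (c₁ + 2 * k * β) c₂ c₃ 0
  set D := cuspDiscr k c₀ c₁ c₂ c₃ d₀ d₁ d₂ d₃ d₄ with hD
  set G := quarticPoly (k * α ^ 2 + c₀ * α + d₀) (2 * k * α * β + c₁ * α + c₀ * β + d₁)
    (k * β ^ 2 + c₂ * α + c₁ * β + d₂) (c₃ * α + c₂ * β + d₃) (c₃ * β + d₄) with hG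
  have hg : ∀ s t : ℂ, eval (s • (c + α • a) + t • (b + β • a)) F =
      (k * α ^ 2 + c₀ * α + d₀) * s ^ 4 + (2 * k * α * β + c₁ * α + c₀ * β + d₁) * s ^ 3 * t +
        (k * β ^ 2 + c₂ * α + c₁ * β + d₂) * s ^ 2 * t ^ 2 +
        (c₃ * α + c₂ * β + d₃) * s * t ^ 3 + (c₃ * β + d₄) * t ^ 4 := by
    intro s t
    rw [show s • (c + α • a) + t • (b + β • a) = (s * α + t * β) • a + s • c + t • b by module,
      h.eval_eq]
    ring
  obtain ⟨e, he⟩ := IsAlgClosed.exists_pow_nat_eq k (n := 2) two_pos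
  have he0 : e ≠ 0 := by
    rintro rfl
    exact hk (by rw [← he]; ring)
  have hAD : A ^ 2 - D = Polynomial.C (2 * e) ^ 2 * G := by
    apply Polynomial.funext
    intro t
    simp [A, hD, hG, cuspDiscr, eval_quarticPoly, ← he]
    ring
  have hsq : IsSquare (A ^ 2 - D) ↔ IsSquare G := by
    rw [hAD]
    constructor
    · rintro ⟨B, hB⟩
      refine ⟨Polynomial.C (2 * e)⁻¹ * B, ?_⟩
      have h1 : Polynomial.C (2 * e)⁻¹ * Polynomial.C (2 * e) = 1 := by
        rw [← Polynomial.C_mul, inv_mul_cancel₀ (mul_ne_zero two_ne_zero he0), Polynomial.C_1]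
      linear_combination (Polynomial.C (2 * e)⁻¹) ^ 2 * hB -
        G * (Polynomial.C (2 * e)⁻¹ * Polynomial.C (2 * e) + 1) * h1
    · exact fun hG => (IsSquare.sq _).mul hG
  have hne : G ≠ 0 := by
    intro h0
    rw [h0, mul_zero, sub_eq_zero] at hAD
    have hdeg : D.degree ≠ 0 := by
      intro h0
      have := Polynomial.natDegree_eq_of_degree_eq_some h0
      rw [h.natDegree_cuspDiscr] at this
      exact absurd this (by norm_num)
    obtain ⟨z, hz⟩ := IsAlgClosed.exists_root D hdeg
    apply h.eval_derivative_cuspDiscr_ne_zero hF ha honly hz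
    have hAz : A.eval z = 0 := by
      rw [← hAD, Polynomial.IsRoot, Polynomial.eval_pow] at hz
      exact sq_eq_zero_iff.mp hz
    rw [← hD, ← hAD, Polynomial.derivative_sq, Polynomial.eval_mul, Polynomial.eval_mul, hAz]
    ring
  rw [hsq]
  constructor
  · rintro ⟨-, -, ht⟩
    exact isSquare_of_everywhereTangent hF hind hg ht
  · intro hs
    exact ⟨⟨_, _, hind, rfl⟩, fun hsub => hne ((lineThrough_subset_curve_iff hF hind hg).mp hsub),
      everywhereTangent_of_isSquare hF hg hne hs⟩

theorem ncard_bitangent_mem (h : CuspidalForm F a c b k c₀ c₁ c₂ c₃ d₀ d₁ d₂ d₃ d₄)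
    (hF : F.IsHomogeneous 4) (ha : a ≠ 0)
    (honly : ∀ q : P2, IsSingularAt F q → q = Projectivization.mk ℂ a ha) :
    {S : Set P2 | Bitangent F S ∧ Projectivization.mk ℂ a ha ∈ S}.ncard = 6 := by
  classical
  have hD0 : cuspDiscr k c₀ c₁ c₂ c₃ d₀ d₁ d₂ d₃ d₄ ≠ 0 :=
    Polynomial.ne_zero_of_natDegree_gt (h.natDegree_cuspDiscr ▸ (by norm_num : 0 < 6))
  have himage : {S : Set P2 | Bitangent F S ∧ Projectivization.mk ℂ a ha ∈ S} =
      (fun z : ℂ => lineThrough a (c + z • b)) ''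
        ((cuspDiscr k c₀ c₁ c₂ c₃ d₀ d₁ d₂ d₃ d₄).roots.toFinset : Set ℂ) := by
    ext S
    simp only [Set.mem_ofPred_eq, Set.mem_image, Finset.mem_coe, Multiset.mem_toFinset,
      Polynomial.mem_roots hD0, Polynomial.IsRoot]
    constructor
    · rintro ⟨hS, haS⟩
      rcases h.eq_tangent_or_exists_pencil_of_mem ha hS.1 haS with rfl | ⟨z, rfl⟩
      · exact absurd hS (h.not_bitangent_tangent hF)
      · exact ⟨z, (h.bitangent_pencil_iff hF z).mp hS, rfl⟩
    · rintro ⟨z, hz, rfl⟩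
      exact ⟨(h.bitangent_pencil_iff hF z).mpr hz,
        (mk_mem_lineThrough_iff ha).mpr (Submodule.subset_span (by simp))⟩
  rw [himage, Set.ncard_image_of_injective _ h.pencil_injective, Set.ncard_coe_finset,
    Multiset.toFinset_card_of_nodup (h.nodup_roots_cuspDiscr hF ha honly),
    Polynomial.splits_iff_card_roots.mp (IsAlgClosed.splits _), h.natDegree_cuspDiscr]

theorem ncard_bitangent_notMem (h : CuspidalForm F a c b k c₀ c₁ c₂ c₃ d₀ d₁ d₂ d₃ d₄)
    (hF : F.IsHomogeneous 4) (ha : a ≠ 0)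
    (honly : ∀ q : P2, IsSingularAt F q → q = Projectivization.mk ℂ a ha) :
    {S : Set P2 | Bitangent F S ∧ Projectivization.mk ℂ a ha ∉ S}.ncard = 10 := by
  have hk2 : 2 * k ≠ 0 := mul_ne_zero two_ne_zero h.k_ne
  set q := quarticPoly c₀ c₁ c₂ c₃ 0 with hq
  have hform : ∀ A : Polynomial ℂ, (A - q).natDegree ≤ 1 →
      A = quarticPoly (c₀ + 2 * k * ((A - q).coeff 0 / (2 * k)))
        (c₁ + 2 * k * ((A - q).coeff 1 / (2 * k))) c₂ c₃ 0 := by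
    intro A hA
    have hAq := Polynomial.eq_X_add_C_of_natDegree_le_one hA
    rw [mul_div_cancel₀ _ hk2, mul_div_cancel₀ _ hk2]
    generalize (A - q).coeff 0 = e₀ at *
    generalize (A - q).coeff 1 = e₁ at *
    rw [sub_eq_iff_eq_add.mp hAq, hq]
    apply Polynomial.funext
    intro t
    simp [eval_quarticPoly]
    ring
  have himage : {S : Set P2 | Bitangent F S ∧ Projectivization.mk ℂ a ha ∉ S} =
      (fun A : Polynomial ℂ => lineThrough (c + ((A - q).coeff 0 / (2 * k)) • a)
        (b + ((A - q).coeff 1 / (2 * k)) • a)) ''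
        {A : Polynomial ℂ | (A - q).natDegree ≤ 1 ∧
          IsSquare (A ^ 2 - cuspDiscr k c₀ c₁ c₂ c₃ d₀ d₁ d₂ d₃ d₄)} := by
    ext S
    simp only [Set.mem_ofPred_eq, Set.mem_image]
    constructor
    · rintro ⟨hS, haS⟩
      obtain ⟨α, β, rfl⟩ := h.exists_graph_of_notMem ha hS.1 haS
      have hdiff : quarticPoly (c₀ + 2 * k * α) (c₁ + 2 * k * β) c₂ c₃ 0 - q =
          Polynomial.C (2 * k * β) * Polynomial.X + Polynomial.C (2 * k * α) := by
        apply Polynomial.funext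
        intro t
        simp [hq, eval_quarticPoly]
        ring
      refine ⟨quarticPoly (c₀ + 2 * k * α) (c₁ + 2 * k * β) c₂ c₃ 0, ⟨?_,
        (h.bitangent_graph_iff hF ha honly α β).mp hS⟩, ?_⟩
      · rw [hdiff]
        exact Polynomial.natDegree_linear_le
      · rw [hdiff]
        simp only [Polynomial.coeff_add, Polynomial.coeff_C_mul, Polynomial.coeff_X_zero,
          Polynomial.coeff_X_one, Polynomial.coeff_C_zero, Polynomial.coeff_C_succ, mul_zero,
          zero_add, mul_one, add_zero, mul_div_cancel_left₀ _ hk2]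
    · rintro ⟨A, ⟨hA, hs⟩, rfl⟩
      rw [hform A hA] at hs
      exact ⟨(h.bitangent_graph_iff hF ha honly _ _).mpr hs, h.mk_notMem_graph ha _ _⟩
  rw [himage, Set.InjOn.ncard_image]
  · exact ncard_isSquare_sq_sub h.natDegree_quarticPoly h.natDegree_cuspDiscr
      (h.nodup_roots_cuspDiscr hF ha honly)
      natDegree_sq_sub_cuspDiscr_le
  · rintro A ⟨hA, -⟩ A' ⟨hA', -⟩ heq
    obtain ⟨h0, h1⟩ := h.graph_injective heq
    rw [hform A hA, hform A' hA', h0, h1]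

end CuspidalForm

/-- An irreducible plane quartic whose only singularity is one ordinary
cusp has exactly 10 theta-lines of type 0, exactly 6 of type 1 (all through the cusp),
and no theta-lines of type 2. -/
theorem unicuspidal_quartic_theta_lines
    (F : MvPolynomial (Fin 3) ℂ) (hF4 : F.IsHomogeneous 4) (hirr : Irreducible F)
    (p : P2) (hp : OrdinaryCusp F p)
    (honly : ∀ q : P2, IsSingularAt F q → q = p) :
    {S : Set P2 | ThetaLineOfType F 0 S}.ncard = 10 ∧
    {S : Set P2 | ThetaLineOfType F 1 S}.ncard = 6 ∧
    (∀ S : Set P2, ThetaLineOfType F 1 S → p ∈ S) ∧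
    {S : Set P2 | ThetaLineOfType F 2 S} = ∅ := by
  induction p using Projectivization.ind with
  | h a ha =>
  obtain ⟨c, b, k, c₀, c₁, c₂, c₃, d₀, d₁, d₂, d₃, d₄, h⟩ := hp.exists_cuspidalForm hF4 ha
  have hsing : ∀ S : Set P2, {x | x ∈ S ∧ IsSingularAt F x} = S ∩ {Projectivization.mk ℂ a ha} := by
    intro S
    ext x
    exact and_congr_right fun _ => ⟨honly x, fun hx => (Set.mem_singleton_iff.mp hx) ▸ hp.1.1⟩
  have htype : ∀ (i : ℕ) (S : Set P2), ThetaLineOfType F i S ↔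
      Bitangent F S ∧ (S ∩ {Projectivization.mk ℂ a ha}).ncard = i := by
    intro i S
    rw [ThetaLineOfType, ThetaLine, Bitangent, hsing]
    tauto
  have hncard_mem : ∀ S : Set P2, Projectivization.mk ℂ a ha ∈ S →
      (S ∩ {Projectivization.mk ℂ a ha}).ncard = 1 := fun S hS => by
    rw [Set.inter_eq_right.mpr (Set.singleton_subset_iff.mpr hS), Set.ncard_singleton]
  have hncard_notMem : ∀ S : Set P2, Projectivization.mk ℂ a ha ∉ S →
      (S ∩ {Projectivization.mk ℂ a ha}).ncard = 0 := fun S hS => by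
    rw [Set.inter_singleton_eq_empty.mpr hS, Set.ncard_empty]
  have h0 : ∀ S, ThetaLineOfType F 0 S ↔ Bitangent F S ∧ Projectivization.mk ℂ a ha ∉ S := by
    intro S
    rw [htype]
    refine and_congr_right fun _ => ⟨fun hS hmem => ?_, hncard_notMem S⟩
    rw [hncard_mem S hmem] at hS
    exact one_ne_zero hS
  have h1 : ∀ S, ThetaLineOfType F 1 S ↔ Bitangent F S ∧ Projectivization.mk ℂ a ha ∈ S := by
    intro S
    rw [htype]
    refine and_congr_right fun _ => ⟨fun hS => ?_, hncard_mem S⟩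
    by_contra hmem
    rw [hncard_notMem S hmem] at hS
    exact zero_ne_one hS
  refine ⟨?_, ?_, fun S hS => ((h1 S).mp hS).2, ?_⟩
  · simp only [h0]
    exact h.ncard_bitangent_notMem hF4 ha honly
  · simp only [h1]
    exact h.ncard_bitangent_mem hF4 ha honly
  · rw [Set.eq_empty_iff_forall_notMem]
    intro S hS
    have hle := Set.ncard_le_ncard (Set.inter_subset_right (s := S))
      (Set.finite_singleton (Projectivization.mk ℂ a ha))
    rw [((htype 2 S).mp hS).2, Set.ncard_singleton] at hle
    exact absurd hle (by norm_num)

end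
end

section
/- Let X be an irreducible plane quartic whose singular locus consists of exactly three ordinary cusps and no other singular points (a tricuspidal quartic). Then X has exactly 1 theta-line of type 0 (a unique bitangent), no theta-lines of type 1, and exactly 3 theta-lines of type 2, namely the three lines joining pairs of cusps. -/
open MvPolynomial

noncomputable section

theorem derivative_lineRest (F : MvPolynomial (Fin 3) ℂ) (a b : Fin 3 → ℂ) :
    Polynomial.derivative (lineRest F a b) =
      ∑ i, Polynomial.C (b i) * lineRest (pderiv i F) a b := by
  unfold lineRest
  induction F using MvPolynomial.induction_on with
  | C c => simp
  | add p q hp hq =>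
    simp only [eval₂_add, hp, hq, map_add, mul_add,
      Finset.sum_add_distrib]
  | mul_X p i hp =>
    simp only [eval₂_mul, eval₂_X, Polynomial.derivative_mul, hp, pderiv_mul, eval₂_add,
      Polynomial.derivative_add, Polynomial.derivative_C, Polynomial.derivative_X, pderiv_X]
    fin_cases i <;> simp [Fin.sum_univ_three, Pi.single_apply] <;> ring

/-- The restriction of a form to a line is determined by its values. -/
theorem lineRest_eq_of_eval_s7 {F : MvPolynomial (Fin 3) ℂ} {a b : Fin 3 → ℂ} {d₀ d₁ d₂ d₃ d₄ : ℂ}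
    (h : ∀ t : ℂ, eval (a + t • b) F = d₀ + d₁ * t + d₂ * t ^ 2 + d₃ * t ^ 3 + d₄ * t ^ 4) :
    lineRest F a b = Polynomial.C d₀ + Polynomial.C d₁ * Polynomial.X +
      Polynomial.C d₂ * Polynomial.X ^ 2 + Polynomial.C d₃ * Polynomial.X ^ 3 +
      Polynomial.C d₄ * Polynomial.X ^ 4 :=
  Polynomial.funext fun t => by rw [eval_lineRest, h]; simp

theorem coneCoeff_eq_of_eval {F : MvPolynomial (Fin 3) ℂ} {a b : Fin 3 → ℂ}
    {d₀ d₁ d₂ d₃ d₄ : ℂ}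
    (h : ∀ t : ℂ, eval (a + t • b) F = d₀ + d₁ * t + d₂ * t ^ 2 + d₃ * t ^ 3 + d₄ * t ^ 4) :
    coneCoeff F a b = d₂ := by
  rw [coneCoeff, lineRest_eq_of_eval_s7 h]
  simp

theorem IsSingularAt.coeff_eq_zero {F : MvPolynomial (Fin 3) ℂ} {a : Fin 3 → ℂ} {ha : a ≠ 0}
    (hs : IsSingularAt F (Projectivization.mk ℂ a ha)) {b : Fin 3 → ℂ} {d₀ d₁ d₂ d₃ d₄ : ℂ}
    (h : ∀ t : ℂ, eval (a + t • b) F = d₀ + d₁ * t + d₂ * t ^ 2 + d₃ * t ^ 3 + d₄ * t ^ 4) :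
    d₀ = 0 ∧ d₁ = 0 := by
  constructor
  · have h0 := hs [] (by simp) a ha rfl
    have := h 0
    simp [pderivList] at h0 this
    rw [← this, h0]
  · have h1 := congrArg (Polynomial.eval 0) (derivative_lineRest F a b)
    have hz : ∀ i, eval a (pderiv i F) = 0 := fun i => hs [i] (by simp) a ha rfl
    rw [lineRest_eq_of_eval_s7 h] at h1
    simpa [Polynomial.eval_finsetSum, eval_lineRest, hz] using h1

/-! ### Coordinates with respect to three independent vectors -/

theorem exists_coords {e₁ e₂ e₃ : Fin 3 → ℂ} (he : LinearIndependent ℂ ![e₁, e₂, e₃]) :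
    ∃ x y z : (Fin 3 → ℂ) →ₗ[ℂ] ℂ, (∀ w, w = x w • e₁ + y w • e₂ + z w • e₃) ∧
      (∀ r s t : ℂ, x (r • e₁ + s • e₂ + t • e₃) = r) ∧
      (∀ r s t : ℂ, y (r • e₁ + s • e₂ + t • e₃) = s) ∧
      (∀ r s t : ℂ, z (r • e₁ + s • e₂ + t • e₃) = t) := by
  let b := basisOfLinearIndependentOfCardEqFinrank he (by simp)
  have hb : ∀ i, b i = ![e₁, e₂, e₃] i := fun i => by simp [b]
  have hb1 : e₁ = b 0 := by simp [hb]
  have hb2 : e₂ = b 1 := by simp [hb]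
  have hb3 : e₃ = b 2 := by simp [hb]
  refine ⟨b.coord 0, b.coord 1, b.coord 2, fun w => ?_, ?_, ?_, ?_⟩
  · conv_lhs => rw [← b.sum_repr w]
    simp [Fin.sum_univ_three, hb]
  all_goals
    intro r s t
    rw [hb1, hb2, hb3]
    simp

theorem coords_inj {e₁ e₂ e₃ : Fin 3 → ℂ} (he : LinearIndependent ℂ ![e₁, e₂, e₃])
    {r s t r' s' t' : ℂ}
    (h : r • e₁ + s • e₂ + t • e₃ = r' • e₁ + s' • e₂ + t' • e₃) : r = r' ∧ s = s' ∧ t = t' := by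
  obtain ⟨x, y, z, -, hx, hy, hz⟩ := exists_coords he
  refine ⟨?_, ?_, ?_⟩
  · rw [← hx r s t, h, hx]
  · rw [← hy r s t, h, hy]
  · rw [← hz r s t, h, hz]

theorem linearIndependent_of_coords {e₁ e₂ e₃ : Fin 3 → ℂ}
    (h : ∀ r s t : ℂ, r • e₁ + s • e₂ + t • e₃ = 0 → r = 0 ∧ s = 0 ∧ t = 0) :
    LinearIndependent ℂ ![e₁, e₂, e₃] := by
  rw [Fintype.linearIndependent_iff]
  intro g hg
  simp only [Fin.sum_univ_three, Matrix.cons_val] at hg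
  obtain ⟨h0, h1, h2⟩ := h _ _ _ hg
  intro i
  fin_cases i <;> assumption

theorem coords_eq_zero {e₁ e₂ e₃ : Fin 3 → ℂ} (he : LinearIndependent ℂ ![e₁, e₂, e₃])
    {r s t : ℂ} (h : r • e₁ + s • e₂ + t • e₃ = 0) : r = 0 ∧ s = 0 ∧ t = 0 :=
  coords_inj he (by rw [h]; simp)

theorem exists_linearIndependent_triple {u v : Fin 3 → ℂ} (h : LinearIndependent ℂ ![u, v]) :
    ∃ w, LinearIndependent ℂ ![u, v, w] := by
  have hlt : 2 < Module.finrank ℂ (Fin 3 → ℂ) := by simp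
  obtain ⟨w, hw⟩ := exists_linearIndependent_snoc_of_lt_finrank h hlt
  have hsnoc : (Fin.snoc ![u, v] w : Fin 3 → Fin 3 → ℂ) = ![u, v, w] := by
    ext i j
    fin_cases i <;> rfl
  rw [hsnoc] at hw
  exact ⟨w, hw⟩

/-- A product of two polynomials without constant term is not irreducible, also when the
factorization is written in linear coordinates. -/
theorem not_irreducible_of_eval_eq_mul {F A B : MvPolynomial (Fin 3) ℂ} {e₁ e₂ e₃ : Fin 3 → ℂ}
    (he : LinearIndependent ℂ ![e₁, e₂, e₃])
    (h : ∀ x y z : ℂ, eval (x • e₁ + y • e₂ + z • e₃) F =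
      eval ![x, y, z] A * eval ![x, y, z] B)
    (hA : eval 0 A = 0) (hB : eval 0 B = 0) : ¬ Irreducible F := by
  obtain ⟨x, y, z, hw, -⟩ := exists_coords he
  let l : ((Fin 3 → ℂ) →ₗ[ℂ] ℂ) → MvPolynomial (Fin 3) ℂ :=
    fun f => ∑ j, C (f (Pi.single j 1)) * X j
  have hl : ∀ f w, eval w (l f) = f w := fun f w => by
    conv_rhs => rw [← Finset.univ_sum_single w]
    simp only [l, map_sum, eval_mul, eval_C, eval_X]
    refine Finset.sum_congr rfl fun j _ => ?_
    rw [show Pi.single j (w j) = w j • (Pi.single j (1 : ℂ) : Fin 3 → ℂ) by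
      rw [← Pi.single_smul, smul_eq_mul, mul_one], map_smul, smul_eq_mul, mul_comm]
  let g : Fin 3 → MvPolynomial (Fin 3) ℂ := ![l x, l y, l z]
  have hg : ∀ w P, eval w (bind₁ g P) = eval ![x w, y w, z w] P := fun w P => by
    rw [eval, eval₂Hom_bind₁, eval]
    congr 2
    ext i
    fin_cases i <;> simp [g] <;> exact hl _ _
  have hF : F = bind₁ g A * bind₁ g B := MvPolynomial.funext fun w => by
    rw [eval_mul, hg, hg, ← h, ← hw]
  have h0 : (![x 0, y 0, z 0] : Fin 3 → ℂ) = 0 := by ext i; fin_cases i <;> simp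
  have hu : ∀ P, eval 0 P = 0 → ¬ IsUnit (bind₁ g P) := fun P hP hu => by
    have := hu.map (eval (0 : Fin 3 → ℂ))
    rw [hg, h0, hP] at this
    exact not_isUnit_zero this
  intro hirr
  rcases hirr.isUnit_or_isUnit hF with h' | h'
  · exact hu A hA h'
  · exact hu B hB h'

/-- The coefficients of a quartic form in linear coordinates. -/
theorem exists_quartic_coeffs {F : MvPolynomial (Fin 3) ℂ} (hF : F.IsHomogeneous 4)
    (e₁ e₂ e₃ : Fin 3 → ℂ) : ∃ c : ℕ → ℕ → ℂ, ∀ x y z : ℂ,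
      eval (x • e₁ + y • e₂ + z • e₃) F =
        ∑ i ∈ Finset.range 5, ∑ j ∈ Finset.range (5 - i), c i j * x ^ i * y ^ j * z ^ (4 - i - j) := by
  let g : Fin 3 → MvPolynomial (Fin 3) ℂ :=
    fun k => C (e₁ k) * X 0 + C (e₂ k) * X 1 + C (e₃ k) * X 2
  have hgh : (bind₁ g F).IsHomogeneous 4 := by
    have hg1 : ∀ k, (g k).IsHomogeneous 1 := fun k =>
      ((isHomogeneous_C_mul_X _ _).add (isHomogeneous_C_mul_X _ _)).add (isHomogeneous_C_mul_X _ _)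
    simpa using hF.aeval g hg1
  have hg : ∀ x y z : ℂ, eval (x • e₁ + y • e₂ + z • e₃) F = eval ![x, y, z] (bind₁ g F) := by
    intro x y z
    rw [eval, eval, eval₂Hom_bind₁]
    congr 2
    ext i
    simp [g]
    ring
  suffices H : ∀ P : MvPolynomial (Fin 3) ℂ, P.IsHomogeneous 4 → ∃ c : ℕ → ℕ → ℂ, ∀ x y z : ℂ,
      eval ![x, y, z] P = ∑ i ∈ Finset.range 5, ∑ j ∈ Finset.range (5 - i),
        c i j * x ^ i * y ^ j * z ^ (4 - i - j) by
    obtain ⟨c, hc⟩ := H _ hgh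
    exact ⟨c, fun x y z => by rw [hg, hc]⟩
  intro P hP
  refine ⟨fun i j => ∑ d ∈ P.support, if d 0 = i ∧ d 1 = j then P.coeff d else 0, fun x y z => ?_⟩
  rw [eval_eq']
  simp only [Finset.sum_mul]
  have hswap : ∀ i ∈ Finset.range 5, (∑ j ∈ Finset.range (5 - i), ∑ d ∈ P.support,
      (if d 0 = i ∧ d 1 = j then P.coeff d else 0) * x ^ i * y ^ j * z ^ (4 - i - j)) =
      ∑ d ∈ P.support, ∑ j ∈ Finset.range (5 - i),
      (if d 0 = i ∧ d 1 = j then P.coeff d else 0) * x ^ i * y ^ j * z ^ (4 - i - j) :=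
    fun i _ => Finset.sum_comm
  rw [Finset.sum_congr rfl hswap, Finset.sum_comm]
  refine Finset.sum_congr rfl fun d hd => ?_
  have hdeg : d 0 + d 1 + d 2 = 4 := by
    have := hP (mem_support_iff.mp hd)
    rw [Finsupp.weight_apply, Finsupp.sum_fintype _ _ (by simp)] at this
    simpa [Fin.sum_univ_three] using this
  rw [Finset.sum_eq_single (d 0), Finset.sum_eq_single (d 1)]
  · simp [Fin.prod_univ_three, show 4 - d 0 - d 1 = d 2 by omega]
    ring
  · intro j _ hj
    simp [Ne.symm hj]
  · intro h
    exact absurd (Finset.mem_range.mpr (by omega)) h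
  · intro i _ hi
    simp [Ne.symm hi]
  · intro h
    exact absurd (Finset.mem_range.mpr (by omega)) h

/-! ### Normal form of a tricuspidal quartic -/

/-- A quartic restricted to the line through two singular points. -/
theorem restrict_of_isSingularAt {F : MvPolynomial (Fin 3) ℂ} {a b : Fin 3 → ℂ} {ha : a ≠ 0}
    {hb : b ≠ 0} (hsa : IsSingularAt F (Projectivization.mk ℂ a ha))
    (hsb : IsSingularAt F (Projectivization.mk ℂ b hb)) {d₀ d₁ d₂ d₃ d₄ : ℂ}
    (h : ∀ x y : ℂ, eval (x • a + y • b) F =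
      d₀ * x ^ 4 + d₁ * x ^ 3 * y + d₂ * x ^ 2 * y ^ 2 + d₃ * x * y ^ 3 + d₄ * y ^ 4) :
    d₀ = 0 ∧ d₁ = 0 ∧ d₃ = 0 ∧ d₄ = 0 := by
  obtain ⟨h0, h1⟩ := hsa.coeff_eq_zero (b := b) (d₀ := d₀) (d₁ := d₁) (d₂ := d₂) (d₃ := d₃)
    (d₄ := d₄) fun t => by
      rw [show a + t • b = (1 : ℂ) • a + t • b by simp, h]; ring
  obtain ⟨h4, h3⟩ := hsb.coeff_eq_zero (b := a) (d₀ := d₄) (d₁ := d₃) (d₂ := d₂) (d₃ := d₁)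
    (d₄ := d₀) fun t => by
      rw [show b + t • a = t • a + (1 : ℂ) • b by simp [add_comm], h]; ring
  exact ⟨h0, h1, h3, h4⟩

/-- Three singular points of an irreducible quartic are not collinear. -/
theorem linearIndependent_of_isSingularAt {F : MvPolynomial (Fin 3) ℂ} (hF : F.IsHomogeneous 4)
    (hirr : Irreducible F) {a b c : Fin 3 → ℂ} {ha : a ≠ 0} {hb : b ≠ 0} {hc : c ≠ 0}
    (hab : Projectivization.mk ℂ a ha ≠ Projectivization.mk ℂ b hb)
    (hac : Projectivization.mk ℂ a ha ≠ Projectivization.mk ℂ c hc)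
    (hbc : Projectivization.mk ℂ b hb ≠ Projectivization.mk ℂ c hc)
    (hsa : IsSingularAt F (Projectivization.mk ℂ a ha))
    (hsb : IsSingularAt F (Projectivization.mk ℂ b hb))
    (hsc : IsSingularAt F (Projectivization.mk ℂ c hc)) : LinearIndependent ℂ ![a, b, c] := by
  have hli : LinearIndependent ℂ ![a, b] := by
    rw [LinearIndependent.pair_iff' ha]
    intro r hr
    exact hab ((Projectivization.mk_eq_mk_iff' ℂ _ _ _ _).mpr
      ⟨r⁻¹, by rw [← hr, smul_smul, inv_mul_cancel₀ (by rintro rfl; simp at hr; exact hb hr.symm),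
        one_smul]⟩)
  obtain ⟨w, hw⟩ := exists_linearIndependent_triple hli
  obtain ⟨x, y, z, hxyz, -⟩ := exists_coords hw
  by_cases hz : z c = 0
  · exfalso
    have hcab : c = x c • a + y c • b := by
      conv_lhs => rw [hxyz c]
      simp [hz]
    have hx : x c ≠ 0 := fun h => hbc <| Eq.symm <|
      (Projectivization.mk_eq_mk_iff' ℂ _ _ _ _).mpr ⟨y c, by conv_rhs => rw [hcab, h, zero_smul, zero_add]⟩
    have hy : y c ≠ 0 := fun h => hac <| Eq.symm <|
      (Projectivization.mk_eq_mk_iff' ℂ _ _ _ _).mpr ⟨x c, by conv_rhs => rw [hcab, h, zero_smul, add_zero]⟩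
    obtain ⟨k, hk⟩ := exists_quartic_coeffs hF a b w
    simp only [Finset.sum_range_succ, Finset.sum_range_zero, Nat.reduceSub] at hk
    obtain ⟨h0, h1, h3, h4⟩ := restrict_of_isSingularAt hsa hsb (d₀ := k 4 0) (d₁ := k 3 1)
      (d₂ := k 2 2) (d₃ := k 1 3) (d₄ := k 0 4) fun x y => by
        rw [show x • a + y • b = x • a + y • b + (0 : ℂ) • w by simp, hk]
        ring
    have h2 : k 2 2 = 0 := by
      have h := hsc [] (by simp) c hc rfl
      rw [show pderivList [] F = F from rfl, hcab,
        show x c • a + y c • b = x c • a + y c • b + (0 : ℂ) • w by simp, hk, h0, h1, h3, h4] at h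
      have h' : k 2 2 * ((x c) ^ 2 * (y c) ^ 2) = 0 := by rw [← h]; ring
      simpa [hx, hy] using h'
    refine not_irreducible_of_eval_eq_mul hw (A := X 2)
      (B := C (k 0 0) * X 2 ^ 3 + C (k 0 1) * X 1 * X 2 ^ 2 + C (k 0 2) * X 1 ^ 2 * X 2 +
        C (k 0 3) * X 1 ^ 3 + C (k 1 0) * X 0 * X 2 ^ 2 + C (k 1 1) * X 0 * X 1 * X 2 +
        C (k 1 2) * X 0 * X 1 ^ 2 + C (k 2 0) * X 0 ^ 2 * X 2 + C (k 2 1) * X 0 ^ 2 * X 1 +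
        C (k 3 0) * X 0 ^ 3) (fun x y z => ?_) (by simp) (by simp) hirr
    rw [hk, h0, h1, h2, h3, h4]
    simp
    ring
  · refine linearIndependent_of_coords fun r s t h => ?_
    rw [hxyz c] at h
    obtain ⟨h1, h2, h3⟩ := coords_eq_zero hw (r := r + t * x c) (s := s + t * y c) (t := t * z c)
      (by rw [← h]; module)
    have ht : t = 0 := by simpa [hz] using h3
    subst ht
    simpa using And.intro h1 h2

/-- The coefficients of a quartic at an ordinary cusp. -/
theorem OrdinaryCusp.coeffs {F : MvPolynomial (Fin 3) ℂ} {e₁ e₂ e₃ : Fin 3 → ℂ}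
    (he : LinearIndependent ℂ ![e₁, e₂, e₃]) {A B C α β γ : ℂ}
    (hF : ∀ x y z : ℂ, eval (x • e₁ + y • e₂ + z • e₃) F =
      A * y ^ 2 * z ^ 2 + B * x ^ 2 * z ^ 2 + C * x ^ 2 * y ^ 2 +
        2 * x * y * z * (α * x + β * y + γ * z))
    {h₁ : e₁ ≠ 0} (hc : OrdinaryCusp F (Projectivization.mk ℂ e₁ h₁)) :
    α ^ 2 = B * C ∧ B ≠ 0 ∧ C ≠ 0 := by
  obtain ⟨b, ⟨-, hb0, hb⟩, hm⟩ := hc.2 e₁ h₁ rfl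
  have hline : ∀ x y z t : ℂ, eval (e₁ + t • (x • e₁ + y • e₂ + z • e₃)) F =
      0 + 0 * t + (B * z ^ 2 + C * y ^ 2 + 2 * α * y * z) * t ^ 2 +
      (2 * x * (B * z ^ 2 + C * y ^ 2) + 2 * y * z * (2 * α * x + β * y + γ * z)) * t ^ 3 +
      (A * y ^ 2 * z ^ 2 + (B * z ^ 2 + C * y ^ 2) * x ^ 2 +
        2 * x * y * z * (α * x + β * y + γ * z)) * t ^ 4 := fun x y z t => by
    rw [show e₁ + t • (x • e₁ + y • e₂ + z • e₃) =
      (1 + t * x) • e₁ + (t * y) • e₂ + (t * z) • e₃ by module, hF]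
    ring
  have hcone := fun x y z => coneCoeff_eq_of_eval (hline x y z)
  obtain ⟨x, y, z, rfl⟩ : ∃ x y z : ℂ, b = x • e₁ + y • e₂ + z • e₃ := by
    obtain ⟨x, y, z, h, -⟩ := exists_coords he
    exact ⟨x b, y b, z b, h b⟩
  rw [hcone] at hb0
  have hnull : ∀ y' z' : ℂ, B * z' ^ 2 + C * y' ^ 2 + 2 * α * y' * z' = 0 → y' * z = z' * y := by
    intro y' z' h
    have h' := hb ((0 : ℂ) • e₁ + y' • e₂ + z' • e₃) (by rw [hcone, h])
    obtain ⟨r, s, hrs⟩ := Submodule.mem_span_pair.mp h'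
    obtain ⟨-, hy, hz⟩ := coords_inj he (r := r + s * x) (s := s * y) (t := s * z)
      (by rw [← hrs]; module)
    rw [← hy, ← hz]
    ring
  have hL := lineRest_eq_of_eval_s7 (hline x y z)
  rw [hb0] at hL
  have hd3 : y * z ≠ 0 := by
    intro h
    have hq : B * z ^ 2 + C * y ^ 2 = 0 := by linear_combination hb0 - 2 * α * h
    have h3 : 2 * x * (B * z ^ 2 + C * y ^ 2) + 2 * y * z * (2 * α * x + β * y + γ * z) = 0 := by
      linear_combination 2 * x * hq + 2 * (2 * α * x + β * y + γ * z) * h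
    have h4 : A * y ^ 2 * z ^ 2 + (B * z ^ 2 + C * y ^ 2) * x ^ 2 +
        2 * x * y * z * (α * x + β * y + γ * z) = 0 := by
      linear_combination x ^ 2 * hq + (A * y * z + 2 * x * (α * x + β * y + γ * z)) * h
    rw [h3, h4] at hL
    simp [multAt, hL] at hm
  obtain ⟨hy, hz⟩ := mul_ne_zero_iff.mp hd3
  have hC : C ≠ 0 := fun h => hz (by simpa using hnull 1 0 (by simp [h]))
  have hB : B ≠ 0 := fun h => hy (by simpa using (hnull 0 1 (by simp [h])).symm)
  have h2 := hnull (-(C * y + 2 * α * z)) (C * z) (by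
    linear_combination C ^ 2 * hb0)
  have hpolar : C * y + α * z = 0 := by
    have : (C * y + α * z) * z = 0 := by linear_combination -h2 / 2
    simpa [hz] using this
  have hpolar' : α * y + B * z = 0 := by
    have : (α * y + B * z) * z = 0 := by linear_combination hb0 - y * hpolar
    simpa [hz] using this
  refine ⟨?_, hB, hC⟩
  have : (α ^ 2 - B * C) * z = 0 := by linear_combination α * hpolar - C * hpolar'
  exact sub_eq_zero.mp (by simpa [hz] using this)

/-- The equation of the standard tricuspidal quartic, with cusps at the coordinate points. -/
def cuspidalForm {R : Type*} [CommRing R] (x y z : R) : R :=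
  y ^ 2 * z ^ 2 + x ^ 2 * z ^ 2 + x ^ 2 * y ^ 2 - 2 * x * y * z * (x + y + z)

/-- In the coordinates given by the basis `e₁, e₂, e₃`, the quartic `F` is proportional to the
standard tricuspidal quartic. -/
def IsCuspidalFrame (F : MvPolynomial (Fin 3) ℂ) (e₁ e₂ e₃ : Fin 3 → ℂ) : Prop :=
  LinearIndependent ℂ ![e₁, e₂, e₃] ∧ ∃ k : ℂ, k ≠ 0 ∧
    ∀ x y z : ℂ, eval (x • e₁ + y • e₂ + z • e₃) F = k * cuspidalForm x y z

theorem LinearIndependent.rotate {e₁ e₂ e₃ : Fin 3 → ℂ}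
    (he : LinearIndependent ℂ ![e₁, e₂, e₃]) : LinearIndependent ℂ ![e₂, e₃, e₁] :=
  linearIndependent_of_coords fun r s t h => by
    obtain ⟨h1, h2, h3⟩ := coords_eq_zero he (r := t) (s := r) (t := s) (by rw [← h]; module)
    exact ⟨h2, h3, h1⟩

theorem exists_isCuspidalFrame {F : MvPolynomial (Fin 3) ℂ} (hF : F.IsHomogeneous 4)
    (hirr : Irreducible F) {p₁ p₂ p₃ : P2} (h12 : p₁ ≠ p₂) (h13 : p₁ ≠ p₃) (h23 : p₂ ≠ p₃)
    (h₁ : OrdinaryCusp F p₁) (h₂ : OrdinaryCusp F p₂) (h₃ : OrdinaryCusp F p₃) :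
    ∃ e₁ e₂ e₃ : Fin 3 → ℂ, IsCuspidalFrame F e₁ e₂ e₃ ∧
      (∃ h, p₁ = Projectivization.mk ℂ e₁ h) ∧ (∃ h, p₂ = Projectivization.mk ℂ e₂ h) ∧
      (∃ h, p₃ = Projectivization.mk ℂ e₃ h) := by
  induction p₁ using Projectivization.ind with | h w₁ hw₁ => ?_
  induction p₂ using Projectivization.ind with | h w₂ hw₂ => ?_
  induction p₃ using Projectivization.ind with | h w₃ hw₃ => ?_
  have hw := linearIndependent_of_isSingularAt hF hirr h12 h13 h23 h₁.1.1 h₂.1.1 h₃.1.1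
  obtain ⟨A, B, D, α, β, γ, hform⟩ : ∃ A B D α β γ : ℂ, ∀ x y z : ℂ,
      eval (x • w₁ + y • w₂ + z • w₃) F =
        A * y ^ 2 * z ^ 2 + B * x ^ 2 * z ^ 2 + D * x ^ 2 * y ^ 2 +
          2 * x * y * z * (α * x + β * y + γ * z) := by
    obtain ⟨k, hk⟩ := exists_quartic_coeffs hF w₁ w₂ w₃
    simp only [Finset.sum_range_succ, Finset.sum_range_zero, Nat.reduceSub] at hk
    obtain ⟨a0, a1, a3, a4⟩ := restrict_of_isSingularAt h₁.1.1 h₂.1.1 (d₀ := k 4 0) (d₁ := k 3 1)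
      (d₂ := k 2 2) (d₃ := k 1 3) (d₄ := k 0 4) fun x y => by
        rw [show x • w₁ + y • w₂ = x • w₁ + y • w₂ + (0 : ℂ) • w₃ by simp, hk]
        ring
    obtain ⟨-, b1, b3, b4⟩ := restrict_of_isSingularAt h₁.1.1 h₃.1.1 (d₀ := k 4 0) (d₁ := k 3 0)
      (d₂ := k 2 0) (d₃ := k 1 0) (d₄ := k 0 0) fun x z => by
        rw [show x • w₁ + z • w₃ = x • w₁ + (0 : ℂ) • w₂ + z • w₃ by simp, hk]
        ring
    obtain ⟨-, c1, c3, -⟩ := restrict_of_isSingularAt h₂.1.1 h₃.1.1 (d₀ := k 0 4) (d₁ := k 0 3)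
      (d₂ := k 0 2) (d₃ := k 0 1) (d₄ := k 0 0) fun y z => by
        rw [show y • w₂ + z • w₃ = (0 : ℂ) • w₁ + y • w₂ + z • w₃ by simp, hk]
        ring
    refine ⟨k 0 2, k 2 0, k 2 2, k 2 1 / 2, k 1 2 / 2, k 1 1 / 2, fun x y z => ?_⟩
    rw [hk, a0, a1, a3, a4, b1, b3, b4, c1, c3]
    ring
  obtain ⟨hα, hB, hD⟩ := OrdinaryCusp.coeffs hw hform h₁
  obtain ⟨hβ, -, hA⟩ := OrdinaryCusp.coeffs hw.rotate (A := B) (B := D) (C := A) (α := β)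
    (β := γ) (γ := α) (fun y z x => by
      rw [show y • w₂ + z • w₃ + x • w₁ = x • w₁ + y • w₂ + z • w₃ by module, hform]; ring) h₂
  obtain ⟨hγ, -, -⟩ := OrdinaryCusp.coeffs hw.rotate.rotate (A := D) (B := A) (C := B) (α := γ)
    (β := α) (γ := β) (fun z x y => by
      rw [show z • w₃ + x • w₁ + y • w₂ = x • w₁ + y • w₂ + z • w₃ by module, hform]; ring) h₃
  obtain ⟨a, ha⟩ := IsAlgClosed.exists_pow_nat_eq A (n := 2) (by norm_num)
  have ha0 : a ≠ 0 := by rintro rfl; simp at ha; exact hA ha.symm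
  subst ha
  have hsign : (β * γ - a ^ 2 * α) * (β * γ + a ^ 2 * α) = 0 := by
    linear_combination γ ^ 2 * hβ + D * a ^ 2 * hγ - a ^ 4 * hα
  set b := γ / a with hb
  set c := β / a with hc
  have hγ' : γ = a * b := by rw [hb]; field_simp
  have hβ' : β = a * c := by rw [hc]; field_simp
  have hB' : B = b ^ 2 := by
    have : a ^ 2 * (B - b ^ 2) = 0 := by rw [hγ'] at hγ; linear_combination -hγ
    exact sub_eq_zero.mp (by simpa [ha0] using this)
  have hD' : D = c ^ 2 := by
    have : a ^ 2 * (D - c ^ 2) = 0 := by rw [hβ'] at hβ; linear_combination -hβ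
    exact sub_eq_zero.mp (by simpa [ha0] using this)
  have hb0 : b ≠ 0 := by rintro h; simp [hB', h] at hB
  have hc0 : c ≠ 0 := by rintro h; simp [hD', h] at hD
  rcases mul_eq_zero.mp hsign with hs | hs
  · have hα' : α = b * c := by
      have : a ^ 2 * (α - b * c) = 0 := by
        rw [hγ', hβ'] at hs; linear_combination -hs
      exact sub_eq_zero.mp (by simpa [ha0] using this)
    exfalso
    let P : MvPolynomial (Fin 3) ℂ := C a * X 1 * X 2 + C b * X 0 * X 2 + C c * X 0 * X 1
    refine not_irreducible_of_eval_eq_mul hw (A := P) (B := P) (fun x y z => ?_)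
      (by simp [P]) (by simp [P]) hirr
    rw [hform, hα', hβ', hγ', hB', hD']
    simp [P]
    ring
  · have hα' : α = -(b * c) := by
      have : a ^ 2 * (α + b * c) = 0 := by
        rw [hγ', hβ'] at hs; linear_combination hs
      exact eq_neg_of_add_eq_zero_left (by simpa [ha0] using this)
    have hmk : ∀ {w : Fin 3 → ℂ} (hw : w ≠ 0) {r : ℂ}, r ≠ 0 →
        ∃ h, Projectivization.mk ℂ w hw = Projectivization.mk ℂ (r • w) h := fun {w} hw {r} hr =>
      ⟨smul_ne_zero hr hw, (Projectivization.mk_eq_mk_iff' ℂ _ _ _ _).mpr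
        ⟨r⁻¹, by rw [smul_smul, inv_mul_cancel₀ hr, one_smul]⟩⟩
    refine ⟨-a • w₁, b • w₂, c • w₃, ⟨linearIndependent_of_coords fun r s t h => ?_,
      a ^ 2 * b ^ 2 * c ^ 2, by simp [ha0, hb0, hc0], fun x y z => ?_⟩, hmk hw₁ (neg_ne_zero.mpr ha0),
      hmk hw₂ hb0, hmk hw₃ hc0⟩
    · obtain ⟨h1, h2, h3⟩ := coords_eq_zero hw (r := r * -a) (s := s * b) (t := t * c)
        (by rw [← h]; module)
      exact ⟨by simpa [ha0] using h1, by simpa [hb0] using h2, by simpa [hc0] using h3⟩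
    · rw [show x • -a • w₁ + y • b • w₂ + z • c • w₃ =
        (x * -a) • w₁ + (y * b) • w₂ + (z * c) • w₃ by module, hform, hα', hβ', hγ', hB', hD',
        cuspidalForm]
      ring

/-! ### Lines as zero loci of linear functionals -/

theorem mk_mem_lineThrough {u v w : Fin 3 → ℂ} {hw : w ≠ 0} :
    Projectivization.mk ℂ w hw ∈ lineThrough u v ↔ ∃ s t : ℂ, w = s • u + t • v := by
  constructor
  · rintro ⟨s, t, h, hp⟩
    obtain ⟨r, hr⟩ := (Projectivization.mk_eq_mk_iff' ℂ _ _ _ _).mp hp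
    exact ⟨r * s, r * t, by rw [← hr]; module⟩
  · rintro ⟨s, t, rfl⟩
    exact ⟨s, t, hw, rfl⟩

/-- `S` is the line in `ℙ²` defined by the nonzero linear functional `l`. -/
def IsZeroLine (l : (Fin 3 → ℂ) →ₗ[ℂ] ℂ) (S : Set P2) : Prop :=
  l ≠ 0 ∧ ∀ (w : Fin 3 → ℂ) (hw : w ≠ 0), Projectivization.mk ℂ w hw ∈ S ↔ l w = 0

theorem IsLine.exists_isZeroLine {S : Set P2} (hS : IsLine S) : ∃ l, IsZeroLine l S := by
  obtain ⟨u, v, huv, rfl⟩ := hS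
  obtain ⟨c, hc⟩ := exists_linearIndependent_triple huv
  obtain ⟨x, y, z, hw, -, -, hz⟩ := exists_coords hc
  refine ⟨z, fun h => ?_, fun w hw0 => mk_mem_lineThrough.trans ⟨?_, fun h => ?_⟩⟩
  · simpa [h] using hz 0 0 1
  · rintro ⟨s, t, rfl⟩
    simpa using hz s t 0
  · exact ⟨x w, y w, by conv_lhs => rw [hw w, h, zero_smul, add_zero]⟩

theorem IsZeroLine.eq_lineThrough {l : (Fin 3 → ℂ) →ₗ[ℂ] ℂ} {S : Set P2} (hS : IsZeroLine l S)
    {a b : Fin 3 → ℂ} (hab : LinearIndependent ℂ ![a, b]) (ha : l a = 0) (hb : l b = 0) :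
    S = lineThrough a b := by
  obtain ⟨c, hc⟩ := exists_linearIndependent_triple hab
  obtain ⟨x, y, z, hw, -⟩ := exists_coords hc
  have hl : ∀ w, l w = z w * l c := fun w => by
    conv_lhs => rw [hw w]
    simp [ha, hb]
  have hlc : l c ≠ 0 := fun h => hS.1 (LinearMap.ext fun w => by rw [hl, h, mul_zero, LinearMap.zero_apply])
  ext p
  induction p using Projectivization.ind with | h w hw0 => ?_
  rw [hS.2, mk_mem_lineThrough, hl]
  constructor
  · intro h
    have hz : z w = 0 := by simpa [hlc] using h
    exact ⟨x w, y w, by conv_lhs => rw [hw w, hz, zero_smul, add_zero]⟩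
  · rintro ⟨s, t, rfl⟩
    rw [← hl]
    simp [ha, hb]

theorem isZeroLine_lineThrough {l : (Fin 3 → ℂ) →ₗ[ℂ] ℂ} {a b : Fin 3 → ℂ}
    (hS : IsZeroLine l (lineThrough a b)) (hab : LinearIndependent ℂ ![a, b]) :
    l a = 0 ∧ l b = 0 :=
  ⟨(hS.2 a (hab.ne_zero 0)).mp (mk_mem_lineThrough.mpr ⟨1, 0, by simp⟩),
    (hS.2 b (hab.ne_zero 1)).mp (mk_mem_lineThrough.mpr ⟨0, 1, by simp⟩)⟩

/-! ### Tangency -/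

theorem MvPolynomial.IsHomogeneous.eval_smul_vec {F : MvPolynomial (Fin 3) ℂ} {n : ℕ}
    (hF : F.IsHomogeneous n) (r : ℂ) (w : Fin 3 → ℂ) :
    eval (r • w) F = r ^ n * eval w F := by
  rw [eval_eq', eval_eq', Finset.mul_sum]
  refine Finset.sum_congr rfl fun d hd => ?_
  have hdeg : d 0 + d 1 + d 2 = n := by
    have := hF (mem_support_iff.mp hd)
    rw [Finsupp.weight_apply, Finsupp.sum_fintype _ _ (by simp)] at this
    simpa [Fin.sum_univ_three] using this
  rw [← hdeg]
  simp only [Fin.prod_univ_three, Pi.smul_apply, smul_eq_mul, mul_pow, pow_add]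
  ring

theorem mk_mem_curve {F : MvPolynomial (Fin 3) ℂ} {n : ℕ} (hF : F.IsHomogeneous n)
    {w : Fin 3 → ℂ} {hw : w ≠ 0} : Projectivization.mk ℂ w hw ∈ curve F ↔ eval w F = 0 := by
  refine ⟨fun h => h w hw rfl, fun h w' hw' hp => ?_⟩
  obtain ⟨r, rfl⟩ := (Projectivization.mk_eq_mk_iff' ℂ _ _ _ _).mp hp
  rw [hF.eval_smul_vec, h, mul_zero]

/-- If a form vanishes on an affine part of a line, then it vanishes on the line. -/
theorem lineThrough_subset_curve {F : MvPolynomial (Fin 3) ℂ} {n : ℕ} (hF : F.IsHomogeneous n)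
    {a b : Fin 3 → ℂ} (h : lineRest F a b = 0) : lineThrough a b ⊆ curve F := by
  have h1 : ∀ s t : ℂ, s ≠ 0 → eval (s • a + t • b) F = 0 := fun s t hs => by
    rw [show s • a + t • b = s • (a + (s⁻¹ * t) • b) by
      rw [smul_add, smul_smul, mul_inv_cancel_left₀ hs], hF.eval_smul_vec, ← eval_lineRest, h]
    simp
  have h2 : ∀ t : ℂ, lineRest F (t • b) a = 0 := fun t => by
    have : Polynomial.X * lineRest F (t • b) a = 0 := Polynomial.funext fun s => by
      rw [Polynomial.eval_mul, eval_lineRest, Polynomial.eval_X]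
      rcases eq_or_ne s 0 with rfl | hs
      · simp
      · rw [add_comm, h1 s t hs]
        simp
    simpa using this
  rintro p ⟨s, t, hst, rfl⟩
  rw [mk_mem_curve hF, add_comm, ← eval_lineRest, h2]
  simp

theorem two_le_multAt_iff {F : MvPolynomial (Fin 3) ℂ} {a b : Fin 3 → ℂ}
    (h : lineRest F a b ≠ 0) :
    2 ≤ multAt F a b ↔ (lineRest F a b).coeff 0 = 0 ∧ (lineRest F a b).coeff 1 = 0 := by
  rw [multAt, Polynomial.le_rootMultiplicity_iff h, Polynomial.C_0, sub_zero,
    Polynomial.X_pow_dvd_iff]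
  refine ⟨fun H => ⟨H 0 (by simp), H 1 (by simp)⟩, fun H d hd => ?_⟩
  interval_cases d
  exacts [H.1, H.2]

/-- The polar of the standard tricuspidal quartic: the derivative at `(x, y, z)` in the
direction `(u, v, w)`. -/
def cuspidalPolar (x y z u v w : ℂ) : ℂ :=
  u * (2 * x * z ^ 2 + 2 * x * y ^ 2 - 2 * y * z * (2 * x + y + z)) +
  v * (2 * y * z ^ 2 + 2 * x ^ 2 * y - 2 * x * z * (x + 2 * y + z)) +
  w * (2 * y ^ 2 * z + 2 * x ^ 2 * z - 2 * x * y * (x + y + 2 * z))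

namespace IsCuspidalFrame

variable {F : MvPolynomial (Fin 3) ℂ} {e₁ e₂ e₃ : Fin 3 → ℂ}

theorem rotate (h : IsCuspidalFrame F e₁ e₂ e₃) : IsCuspidalFrame F e₂ e₃ e₁ := by
  obtain ⟨hli, k, hk, hF⟩ := h
  refine ⟨hli.rotate, k, hk, fun y z x => ?_⟩
  rw [show y • e₂ + z • e₃ + x • e₁ = x • e₁ + y • e₂ + z • e₃ by module, hF, cuspidalForm,
    cuspidalForm]
  ring

theorem eval_eq_zero_iff (h : IsCuspidalFrame F e₁ e₂ e₃) (x y z : ℂ) :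
    eval (x • e₁ + y • e₂ + z • e₃) F = 0 ↔ cuspidalForm x y z = 0 := by
  obtain ⟨-, k, hk, hF⟩ := h
  simp [hF, hk]

theorem coeff_zero_eq_zero_iff (h : IsCuspidalFrame F e₁ e₂ e₃) (x y z : ℂ) (b : Fin 3 → ℂ) :
    (lineRest F (x • e₁ + y • e₂ + z • e₃) b).coeff 0 = 0 ↔ cuspidalForm x y z = 0 := by
  rw [← h.eval_eq_zero_iff, Polynomial.coeff_zero_eq_eval_zero, eval_lineRest, zero_smul, add_zero]

theorem coeff_one_eq_zero_iff (h : IsCuspidalFrame F e₁ e₂ e₃) (x y z u v w : ℂ) :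
    (lineRest F (x • e₁ + y • e₂ + z • e₃) (u • e₁ + v • e₂ + w • e₃)).coeff 1 = 0 ↔
      cuspidalPolar x y z u v w = 0 := by
  obtain ⟨-, k, hk, hF⟩ := h
  have hL : lineRest F (x • e₁ + y • e₂ + z • e₃) (u • e₁ + v • e₂ + w • e₃) =
      Polynomial.C k * cuspidalForm (Polynomial.C x + Polynomial.C u * Polynomial.X)
        (Polynomial.C y + Polynomial.C v * Polynomial.X)
        (Polynomial.C z + Polynomial.C w * Polynomial.X) := Polynomial.funext fun t => by
    rw [eval_lineRest, show x • e₁ + y • e₂ + z • e₃ + t • (u • e₁ + v • e₂ + w • e₃) =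
      (x + u * t) • e₁ + (y + v * t) • e₂ + (z + w * t) • e₃ by module, hF]
    simp [cuspidalForm]
  have h1 : (lineRest F (x • e₁ + y • e₂ + z • e₃) (u • e₁ + v • e₂ + w • e₃)).coeff 1 =
      k * cuspidalPolar x y z u v w := by
    have : ∀ p : Polynomial ℂ, p.coeff 1 = (Polynomial.derivative p).eval 0 := fun p => by
      rw [← Polynomial.coeff_zero_eq_eval_zero, Polynomial.coeff_derivative]
      simp
    rw [this, hL]
    simp [cuspidalForm, cuspidalPolar, Polynomial.derivative_pow, -mul_eq_mul_left_iff]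
    ring
  simp [h1, hk]

theorem polar_eq_zero (h : IsCuspidalFrame F e₁ e₂ e₃) (hF : F.IsHomogeneous 4)
    {l : (Fin 3 → ℂ) →ₗ[ℂ] ℂ} {S : Set P2} (hS : IsZeroLine l S) (hT : EverywhereTangent F S)
    {x y z u v w : ℂ} (ha : x * l e₁ + y * l e₂ + z * l e₃ = 0)
    (hb : u * l e₁ + v * l e₂ + w * l e₃ = 0)
    (hli : ∀ s t : ℂ, s * x + t * u = 0 → s * y + t * v = 0 → s * z + t * w = 0 → s = 0 ∧ t = 0)
    (h0 : cuspidalForm x y z = 0) : cuspidalPolar x y z u v w = 0 := by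
  have hab : LinearIndependent ℂ
      ![x • e₁ + y • e₂ + z • e₃, u • e₁ + v • e₂ + w • e₃] := by
    rw [LinearIndependent.pair_iff]
    intro s t hst
    obtain ⟨h1, h2, h3⟩ := coords_eq_zero h.1 (r := s * x + t * u) (s := s * y + t * v)
      (t := s * z + t * w) (by rw [← hst]; module)
    exact hli s t h1 h2 h3
  have hST := hS.eq_lineThrough hab (by simpa using ha) (by simpa using hb)
  have hm := hT _ _ hab hST (hab.ne_zero 0)
    ((mk_mem_curve hF).mpr ((h.eval_eq_zero_iff x y z).mpr h0))
  have hne : lineRest F (x • e₁ + y • e₂ + z • e₃) (u • e₁ + v • e₂ + w • e₃) ≠ 0 := by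
    intro h'
    simp [multAt, h'] at hm
  exact (h.coeff_one_eq_zero_iff x y z u v w).mp ((two_le_multAt_iff hne).mp hm).2

theorem everywhereTangent (h : IsCuspidalFrame F e₁ e₂ e₃) (hF : F.IsHomogeneous 4)
    {l : (Fin 3 → ℂ) →ₗ[ℂ] ℂ} {S : Set P2} (hS : IsZeroLine l S) (hc : ¬ S ⊆ curve F)
    (hp : ∀ x y z u v w : ℂ, x * l e₁ + y * l e₂ + z * l e₃ = 0 →
      u * l e₁ + v * l e₂ + w * l e₃ = 0 → cuspidalForm x y z = 0 →
      cuspidalPolar x y z u v w = 0) : EverywhereTangent F S := by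
  rintro a b hab rfl ha0 ha
  have hne : lineRest F a b ≠ 0 := fun h' => hc (lineThrough_subset_curve hF h')
  obtain ⟨hla, hlb⟩ := isZeroLine_lineThrough hS hab
  obtain ⟨X, Y, Z, hw, -⟩ := exists_coords h.1
  rw [two_le_multAt_iff hne]
  rw [mk_mem_curve hF] at ha
  rw [hw a] at hla ha ⊢
  rw [hw b] at hlb ⊢
  rw [h.eval_eq_zero_iff] at ha
  exact ⟨(h.coeff_zero_eq_zero_iff _ _ _ _).mpr ha, (h.coeff_one_eq_zero_iff _ _ _ _ _ _).mpr
    (hp _ _ _ _ _ _ (by simpa using hla) (by simpa using hlb) ha)⟩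

theorem not_subset_curve (h : IsCuspidalFrame F e₁ e₂ e₃) (hF : F.IsHomogeneous 4)
    {l : (Fin 3 → ℂ) →ₗ[ℂ] ℂ} {S : Set P2} (hS : IsZeroLine l S)
    {x y z : ℂ} (hl : x * l e₁ + y * l e₂ + z * l e₃ = 0)
    (hne : cuspidalForm x y z ≠ 0) : ¬ S ⊆ curve F := by
  intro hc
  have hw : x • e₁ + y • e₂ + z • e₃ ≠ 0 := fun h0 => by
    obtain ⟨rfl, rfl, rfl⟩ := coords_eq_zero h.1 h0
    simp [cuspidalForm] at hne
  have := (mk_mem_curve hF).mp (hc ((hS.2 _ hw).mpr (by simpa using hl)))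
  exact hne ((h.eval_eq_zero_iff x y z).mp this)

/-- A line through two cusps is a theta-line. -/
theorem of_two_cusps (h : IsCuspidalFrame F e₁ e₂ e₃) (hF : F.IsHomogeneous 4)
    {l : (Fin 3 → ℂ) →ₗ[ℂ] ℂ} {S : Set P2} (hS : IsZeroLine l S)
    (h1 : l e₁ = 0) (h2 : l e₂ = 0) (h3 : l e₃ ≠ 0) :
    ¬ S ⊆ curve F ∧ EverywhereTangent F S := by
  have hc := h.not_subset_curve hF hS (x := 1) (y := 1) (z := 0) (by simp [h1, h2])
    (by simp [cuspidalForm])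
  refine ⟨hc, h.everywhereTangent hF hS hc fun x y z u v w ha hb h0 => ?_⟩
  have hz : z = 0 := by simpa [h1, h2, h3] using ha
  have hw : w = 0 := by simpa [h1, h2, h3] using hb
  subst hz hw
  have hxy : x * y = 0 := by simpa [cuspidalForm] using h0
  rw [cuspidalPolar]
  linear_combination 2 * (u * y + v * x) * hxy

/-- The unit line of the frame is a bitangent. -/
theorem of_unit_line (h : IsCuspidalFrame F e₁ e₂ e₃) (hF : F.IsHomogeneous 4)
    {l : (Fin 3 → ℂ) →ₗ[ℂ] ℂ} {S : Set P2} (hS : IsZeroLine l S)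
    (h1 : l e₁ = l e₃) (h2 : l e₂ = l e₃) (h3 : l e₃ ≠ 0) :
    ¬ S ⊆ curve F ∧ EverywhereTangent F S := by
  have hc := h.not_subset_curve hF hS (x := 1) (y := -1) (z := 0) (by simp [h1, h2])
    (by simp [cuspidalForm])
  refine ⟨hc, h.everywhereTangent hF hS hc fun x y z u v w ha hb h0 => ?_⟩
  rw [h1, h2, ← add_mul, ← add_mul] at ha hb
  have hz : x + y + z = 0 := by simpa [h3] using ha
  have hw : u + v + w = 0 := by simpa [h3] using hb
  obtain rfl : z = -x - y := by linear_combination hz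
  obtain rfl : w = -u - v := by linear_combination hw
  have hq : x ^ 2 + x * y + y ^ 2 = 0 := by
    have : (x ^ 2 + x * y + y ^ 2) ^ 2 = 0 := by
      rw [← h0, cuspidalForm]
      ring
    simpa using this
  rw [cuspidalPolar]
  linear_combination 2 * (2 * x * u + x * v + y * u + 2 * y * v) * hq

/-- A line through exactly one cusp is not a theta-line. -/
theorem not_everywhereTangent_of_one_cusp (h : IsCuspidalFrame F e₁ e₂ e₃)
    (hF : F.IsHomogeneous 4) {l : (Fin 3 → ℂ) →ₗ[ℂ] ℂ} {S : Set P2} (hS : IsZeroLine l S)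
    (h1 : l e₁ ≠ 0) (h2 : l e₂ ≠ 0) (h3 : l e₃ = 0) : ¬ EverywhereTangent F S := by
  intro hT
  obtain ⟨m, hm⟩ : ∃ m, m = -l e₁ / l e₂ := ⟨_, rfl⟩
  have hm0 : m ≠ 0 := by simp [hm, h1, h2]
  have hml : l e₁ + m * l e₂ = 0 := by rw [hm]; field_simp; ring
  have key : ∀ z : ℂ, m ^ 2 - 2 * m * (1 + m) * z + (1 - m) ^ 2 * z ^ 2 = 0 →
      (1 - m) ^ 2 * z - m * (1 + m) = 0 := fun z hz => by
    have := h.polar_eq_zero hF hS hT (x := 1) (y := m) (z := z) (u := 0) (v := 0) (w := 1)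
      (by simpa [h3] using hml) (by simp [h3])
      (fun s t h1 _ h3 => by
        have hs : s = 0 := by simpa using h1
        subst hs
        simpa using h3)
      (by rw [cuspidalForm]; linear_combination hz)
    rw [cuspidalPolar] at this
    linear_combination this / 2
  by_cases hm1 : m = 1
  · subst hm1
    have := key (1 / 4) (by norm_num)
    norm_num at this
  · have hm1' : (1 - m) ^ 2 ≠ 0 := pow_ne_zero 2 (sub_ne_zero.mpr (Ne.symm hm1))
    obtain ⟨z, hz⟩ := exists_quadratic_eq_zero (a := (1 - m) ^ 2) (b := -2 * m * (1 + m))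
      (c := m ^ 2) hm1' (by
        obtain ⟨s, hs⟩ := IsAlgClosed.exists_pow_nat_eq
          (discrim ((1 - m) ^ 2) (-2 * m * (1 + m)) (m ^ 2)) (n := 2) (by norm_num)
        exact ⟨s, by rw [← hs, sq]⟩)
    have hz' := key z (by linear_combination hz)
    have : m ^ 3 = 0 := by
      linear_combination (-(1 - m) ^ 2 * hz + ((1 - m) ^ 2 * z - m * (1 + m)) * hz') / 4
    exact hm0 (by simpa using this)

end IsCuspidalFrame

/-- A complex quartic polynomial without simple roots is a multiple of a square. -/
theorem quartic_eq_square_of_roots_multiple {c₀ c₁ c₂ c₃ c₄ : ℂ} (hc : c₄ ≠ 0)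
    (h : ∀ x : ℂ, c₀ + c₁ * x + c₂ * x ^ 2 + c₃ * x ^ 3 + c₄ * x ^ 4 = 0 →
      c₁ + 2 * c₂ * x + 3 * c₃ * x ^ 2 + 4 * c₄ * x ^ 3 = 0) :
    ∃ p q : ℂ, c₃ = c₄ * (2 * p) ∧ c₂ = c₄ * (p ^ 2 + 2 * q) ∧ c₁ = c₄ * (2 * p * q) ∧
      c₀ = c₄ * q ^ 2 := by
  obtain ⟨r, hr⟩ := IsAlgClosed.exists_root (Polynomial.C c₀ + Polynomial.C c₁ * Polynomial.X +
    Polynomial.C c₂ * Polynomial.X ^ 2 + Polynomial.C c₃ * Polynomial.X ^ 3 +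
    Polynomial.C c₄ * Polynomial.X ^ 4) (by
      rw [show Polynomial.degree _ = ((4 : ℕ) : WithBot ℕ) by compute_degree!]
      norm_num)
  replace hr : c₀ + c₁ * r + c₂ * r ^ 2 + c₃ * r ^ 3 + c₄ * r ^ 4 = 0 := by simpa using hr
  have hr' := h r hr
  set p := c₃ + 2 * r * c₄ with hp
  set q := c₂ + 2 * r * p - r ^ 2 * c₄ with hq
  have hf : ∀ x, c₀ + c₁ * x + c₂ * x ^ 2 + c₃ * x ^ 3 + c₄ * x ^ 4 =
      (x - r) ^ 2 * (c₄ * x ^ 2 + p * x + q) := fun x => by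
    rw [hq, hp]
    linear_combination hr + (x - r) * hr'
  have hf' : ∀ x, c₁ + 2 * c₂ * x + 3 * c₃ * x ^ 2 + 4 * c₄ * x ^ 3 =
      2 * (x - r) * (c₄ * x ^ 2 + p * x + q) + (x - r) ^ 2 * (2 * c₄ * x + p) := fun x => by
    rw [hq, hp]
    linear_combination hr'
  have hmul : ∀ x, c₄ * x ^ 2 + p * x + q = 0 → x = r ∨ 2 * c₄ * x + p = 0 := fun x hx => by
    have := h x (by rw [hf, hx, mul_zero])
    rw [hf', hx] at this
    simpa [sub_eq_zero] using this
  obtain ⟨s, hs⟩ := exists_quadratic_eq_zero (a := c₄) (b := p) (c := q) hc (by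
    obtain ⟨s, hs⟩ := IsAlgClosed.exists_pow_nat_eq (discrim c₄ p q) (n := 2) (by norm_num)
    exact ⟨s, by rw [← hs, sq]⟩)
  have hs0 : c₄ * s ^ 2 + p * s + q = 0 := by linear_combination hs
  have hs1 : 2 * c₄ * s + p = 0 := by
    rcases hmul s hs0 with rfl | h'
    · have hpc : c₄ * (p / c₄) = p := by field_simp
      rcases hmul (-(p / c₄) - s) (by linear_combination hs0 + (p / c₄ + 2 * s) * hpc)
        with h'' | h''
      · linear_combination -c₄ * h'' - hpc
      · linear_combination -h'' - 2 * hpc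
    · exact h'
  have hp' : p = -2 * c₄ * s := by linear_combination hs1
  have hq' : q = c₄ * s ^ 2 := by linear_combination hs0 - s * hs1
  have hc3 : c₃ = -2 * c₄ * s - 2 * r * c₄ := by linear_combination hp' - hp
  have hc2 : c₂ = c₄ * s ^ 2 + 4 * r * s * c₄ + r ^ 2 * c₄ := by
    linear_combination hq' - hq - 2 * r * hp'
  have hc1 : c₁ = -2 * c₄ * r * s * (r + s) := by
    rw [hc3, hc2] at hr'
    linear_combination hr'
  refine ⟨-(r + s), r * s, by rw [hc3]; ring, by rw [hc2]; ring, by rw [hc1]; ring, ?_⟩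
  rw [hc3, hc2, hc1] at hr
  linear_combination hr

/-- A theta-line through none of the cusps is the unit line of the frame. -/
theorem IsCuspidalFrame.unit_line_of_everywhereTangent {F : MvPolynomial (Fin 3) ℂ}
    {e₁ e₂ e₃ : Fin 3 → ℂ} (h : IsCuspidalFrame F e₁ e₂ e₃)
    (hF : F.IsHomogeneous 4) {l : (Fin 3 → ℂ) →ₗ[ℂ] ℂ} {S : Set P2} (hS : IsZeroLine l S)
    (h1 : l e₁ ≠ 0) (h2 : l e₂ ≠ 0) (h3 : l e₃ ≠ 0) (hT : EverywhereTangent F S) :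
    l e₁ = l e₃ ∧ l e₂ = l e₃ := by
  obtain ⟨u, hu⟩ : ∃ u, u = -l e₁ / l e₃ := ⟨_, rfl⟩
  obtain ⟨v, hv⟩ : ∃ v, v = -l e₂ / l e₃ := ⟨_, rfl⟩
  have hu0 : u ≠ 0 := by simp [hu, h1, h3]
  have hv0 : v ≠ 0 := by simp [hv, h2, h3]
  have hul : l e₁ = -u * l e₃ := by rw [hu]; field_simp
  have hvl : l e₂ = -v * l e₃ := by rw [hv]; field_simp
  obtain ⟨p, q, e3, e2, e1, e0⟩ := quartic_eq_square_of_roots_multiple (c₀ := v ^ 2)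
    (c₁ := 2 * u * v - 2 * v ^ 2 - 2 * v)
    (c₂ := u ^ 2 - 4 * u * v + v ^ 2 - 2 * u - 2 * v + 1)
    (c₃ := 2 * u * v - 2 * u ^ 2 - 2 * u) (c₄ := u ^ 2) (pow_ne_zero 2 hu0) fun x hx => by
      have := h.polar_eq_zero hF hS hT (x := x) (y := 1) (z := u * x + v) (u := 1) (v := 0)
        (w := u) (by rw [hul, hvl]; ring) (by rw [hul]; ring)
        (fun s t h1 h2 _ => by
          have hs : s = 0 := by simpa using h2
          subst hs
          simpa using h1)
        (by rw [cuspidalForm]; linear_combination hx)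
      rw [cuspidalPolar] at this
      linear_combination this
  have hp : u * p = v - u - 1 := by
    have : u * (u * p - (v - u - 1)) = 0 := by linear_combination -e3 / 2
    exact sub_eq_zero.mp (by simpa [hu0] using this)
  have hpq : u * p * (u * q) = v * (u - v - 1) := by linear_combination -e1 / 2
  have hq : (u * q - v) * (u * q + v) = 0 := by linear_combination -e0
  rcases mul_eq_zero.mp hq with hq | hq
  · have hq' : u * q = v := by linear_combination hq
    rw [hp, hq'] at hpq
    have huv : u = v := by
      have : v * (u - v) = 0 := by linear_combination -hpq / 2
      exact sub_eq_zero.mp (by simpa [hv0] using this)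
    subst huv
    have : u * (u + 1) = 0 := by
      linear_combination -(e2 + (u * p - 1) * hp + 2 * u * hq') / 4
    have hu1 : u = -1 := eq_neg_of_add_eq_zero_left (by simpa [hu0] using this)
    subst hu1
    exact ⟨by rw [hul]; ring, by rw [hvl]; ring⟩
  · exfalso
    have hq' : u * q = -v := by linear_combination hq
    rw [hp, hq'] at hpq
    have : v = 0 := by linear_combination hpq / 2
    exact hv0 this

/-- The number of cusps on a line. -/
theorem ncard_singular_mem_isZeroLine {F : MvPolynomial (Fin 3) ℂ} {e₁ e₂ e₃ : Fin 3 → ℂ}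
    {h₁ : e₁ ≠ 0} {h₂ : e₂ ≠ 0} {h₃ : e₃ ≠ 0}
    (h12 : Projectivization.mk ℂ e₁ h₁ ≠ Projectivization.mk ℂ e₂ h₂)
    (h13 : Projectivization.mk ℂ e₁ h₁ ≠ Projectivization.mk ℂ e₃ h₃)
    (h23 : Projectivization.mk ℂ e₂ h₂ ≠ Projectivization.mk ℂ e₃ h₃)
    (hsing : ∀ q, IsSingularAt F q ↔ q = Projectivization.mk ℂ e₁ h₁ ∨
      q = Projectivization.mk ℂ e₂ h₂ ∨ q = Projectivization.mk ℂ e₃ h₃)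
    {l : (Fin 3 → ℂ) →ₗ[ℂ] ℂ} {S : Set P2} (hS : IsZeroLine l S) :
    {p | p ∈ S ∧ IsSingularAt F p}.ncard =
      (if l e₁ = 0 then 1 else 0) + (if l e₂ = 0 then 1 else 0) + (if l e₃ = 0 then 1 else 0) := by
  classical
  have hset : {p | p ∈ S ∧ IsSingularAt F p} = ↑(({Projectivization.mk ℂ e₁ h₁,
      Projectivization.mk ℂ e₂ h₂, Projectivization.mk ℂ e₃ h₃} : Finset P2).filter (· ∈ S)) := by
    ext p
    simp [hsing, and_comm]
  rw [hset, Set.ncard_coe_finset, Finset.card_filter, Finset.sum_insert (by simp [h12, h13]),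
    Finset.sum_insert (by simp [h23]), Finset.sum_singleton]
  simp only [hS.2, add_assoc]

/-- A theta-line which is not a component of the quartic passes through two cusps or is the
unit line of the frame. -/
theorem IsCuspidalFrame.eq_of_everywhereTangent {F : MvPolynomial (Fin 3) ℂ}
    {e₁ e₂ e₃ : Fin 3 → ℂ} (h : IsCuspidalFrame F e₁ e₂ e₃) (hF : F.IsHomogeneous 4)
    {l : (Fin 3 → ℂ) →ₗ[ℂ] ℂ} {S : Set P2} (hS : IsZeroLine l S) (hT : EverywhereTangent F S) :
    (l e₁ = l e₃ ∧ l e₂ = l e₃ ∧ l e₃ ≠ 0) ∨ (l e₁ = 0 ∧ l e₂ = 0 ∧ l e₃ ≠ 0) ∨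
      (l e₁ = 0 ∧ l e₂ ≠ 0 ∧ l e₃ = 0) ∨ (l e₁ ≠ 0 ∧ l e₂ = 0 ∧ l e₃ = 0) := by
  have h000 : ¬ (l e₁ = 0 ∧ l e₂ = 0 ∧ l e₃ = 0) := by
    rintro ⟨h1, h2, h3⟩
    obtain ⟨x, y, z, hw, -⟩ := exists_coords h.1
    refine hS.1 (LinearMap.ext fun w => ?_)
    rw [hw w]
    simp [h1, h2, h3]
  have h1 := fun a b c => h.not_everywhereTangent_of_one_cusp hF hS a b c hT
  have h2 := fun a b c => h.rotate.not_everywhereTangent_of_one_cusp hF hS a b c hT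
  have h3 := fun a b c => h.rotate.rotate.not_everywhereTangent_of_one_cusp hF hS a b c hT
  have h4 := fun a b c => h.unit_line_of_everywhereTangent hF hS a b c hT
  tauto

theorem linearIndependent_pair_of_triple {e₁ e₂ e₃ : Fin 3 → ℂ}
    (he : LinearIndependent ℂ ![e₁, e₂, e₃]) : LinearIndependent ℂ ![e₁, e₂] := by
  rw [LinearIndependent.pair_iff]
  intro s t h
  obtain ⟨h1, h2, -⟩ := coords_eq_zero he (r := s) (s := t) (t := 0) (by simp [h])
  exact ⟨h1, h2⟩

/-- The functional of a line through two members of a basis does not vanish at the third. -/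
theorem IsZeroLine.ne_zero_of_eq_zero {e₁ e₂ e₃ : Fin 3 → ℂ}
    (he : LinearIndependent ℂ ![e₁, e₂, e₃]) {l : (Fin 3 → ℂ) →ₗ[ℂ] ℂ} {S : Set P2}
    (hS : IsZeroLine l S) (h1 : l e₁ = 0) (h2 : l e₂ = 0) : l e₃ ≠ 0 := by
  intro h3
  obtain ⟨x, y, z, hw, -⟩ := exists_coords he
  refine hS.1 (LinearMap.ext fun w => ?_)
  rw [hw w]
  simp [h1, h2, h3]

theorem exists_isZeroLine_lineThrough {a b : Fin 3 → ℂ} (hab : LinearIndependent ℂ ![a, b]) :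
    ∃ l, IsZeroLine l (lineThrough a b) ∧ l a = 0 ∧ l b = 0 := by
  obtain ⟨l, hl⟩ := IsLine.exists_isZeroLine ⟨a, b, hab, rfl⟩
  exact ⟨l, hl, isZeroLine_lineThrough hl hab⟩

/-- An irreducible plane quartic whose only singularities are three
ordinary cusps (a tricuspidal quartic) has exactly 1 theta-line of type 0 (a unique
bitangent), no theta-lines of type 1, and exactly 3 theta-lines of type 2, namely the
lines joining pairs of cusps. -/
theorem tricuspidal_quartic_theta_lines
    (F : MvPolynomial (Fin 3) ℂ) (hF4 : F.IsHomogeneous 4) (hirr : Irreducible F)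
    (p₁ p₂ p₃ : P2) (h12 : p₁ ≠ p₂) (h13 : p₁ ≠ p₃) (h23 : p₂ ≠ p₃)
    (h₁ : OrdinaryCusp F p₁) (h₂ : OrdinaryCusp F p₂) (h₃ : OrdinaryCusp F p₃)
    (honly : ∀ q : P2, IsSingularAt F q → q = p₁ ∨ q = p₂ ∨ q = p₃) :
    {S : Set P2 | ThetaLineOfType F 0 S}.ncard = 1 ∧
    {S : Set P2 | ThetaLineOfType F 1 S} = ∅ ∧
    {S : Set P2 | ThetaLineOfType F 2 S}.ncard = 3 ∧
    (∀ S : Set P2, ThetaLineOfType F 2 S →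
      (p₁ ∈ S ∧ p₂ ∈ S) ∨ (p₁ ∈ S ∧ p₃ ∈ S) ∨ (p₂ ∈ S ∧ p₃ ∈ S)) := by
  obtain ⟨e₁, e₂, e₃, hfr, ⟨hn₁, rfl⟩, ⟨hn₂, rfl⟩, ⟨hn₃, rfl⟩⟩ :=
    exists_isCuspidalFrame hF4 hirr h12 h13 h23 h₁ h₂ h₃
  have hcount := fun {l S} => ncard_singular_mem_isZeroLine (l := l) (S := S) h12 h13 h23
    fun q => ⟨honly q, by rintro (rfl | rfl | rfl); exacts [h₁.1.1, h₂.1.1, h₃.1.1]⟩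
  have hli := hfr.1
  have hli12 := linearIndependent_pair_of_triple hli
  have hli23 := linearIndependent_pair_of_triple hli.rotate
  have hli31 := linearIndependent_pair_of_triple hli.rotate.rotate
  have hliB : LinearIndependent ℂ ![e₁ - e₃, e₂ - e₃] := by
    rw [LinearIndependent.pair_iff]
    intro s t h
    obtain ⟨hs, ht, -⟩ := coords_eq_zero hli (r := s) (s := t) (t := -s - t) (by rw [← h]; module)
    exact ⟨hs, ht⟩
  obtain ⟨lB, hB, hB1, hB2⟩ := exists_isZeroLine_lineThrough hliB
  obtain ⟨l₃, hl₃, h31, h32⟩ := exists_isZeroLine_lineThrough hli12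
  obtain ⟨l₁, hl₁, h12', h13'⟩ := exists_isZeroLine_lineThrough hli23
  obtain ⟨l₂, hl₂, h23', h21'⟩ := exists_isZeroLine_lineThrough hli31
  have h33 := hl₃.ne_zero_of_eq_zero hli h31 h32
  have h11 := hl₁.ne_zero_of_eq_zero hli.rotate h12' h13'
  have h22 := hl₂.ne_zero_of_eq_zero hli.rotate.rotate h23' h21'
  rw [map_sub, sub_eq_zero] at hB1 hB2
  have hB3 : lB e₃ ≠ 0 := fun h0 =>
    hB.ne_zero_of_eq_zero hli (hB1.trans h0) (hB2.trans h0) h0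
  have htype : ∀ i S, ThetaLineOfType F i S → (i = 0 ∧ S = lineThrough (e₁ - e₃) (e₂ - e₃)) ∨
      (i = 2 ∧ (S = lineThrough e₁ e₂ ∨ S = lineThrough e₂ e₃ ∨ S = lineThrough e₃ e₁)) := by
    rintro i S ⟨⟨hline, hT⟩, hc, rfl⟩
    obtain ⟨l, hl⟩ := hline.exists_isZeroLine
    rw [hcount hl]
    rcases hfr.eq_of_everywhereTangent hF4 hl (hT.resolve_left hc) with
      ⟨a, b, c⟩ | ⟨a, b, c⟩ | ⟨a, b, c⟩ | ⟨a, b, c⟩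
    · exact Or.inl ⟨by simp [a, b, c], hl.eq_lineThrough hliB (by simp [a]) (by simp [b])⟩
    · exact Or.inr ⟨by simp [a, b, c], Or.inl (hl.eq_lineThrough hli12 a b)⟩
    · exact Or.inr ⟨by simp [a, b, c], Or.inr (Or.inr (hl.eq_lineThrough hli31 c a))⟩
    · exact Or.inr ⟨by simp [a, b, c], Or.inr (Or.inl (hl.eq_lineThrough hli23 b c))⟩
  have htB : ThetaLineOfType F 0 (lineThrough (e₁ - e₃) (e₂ - e₃)) := by
    obtain ⟨hc, hT⟩ := hfr.of_unit_line hF4 hB hB1 hB2 hB3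
    exact ⟨⟨⟨_, _, hliB, rfl⟩, Or.inr hT⟩, hc, by simp [hcount hB, hB1, hB2, hB3]⟩
  have ht₃ : ThetaLineOfType F 2 (lineThrough e₁ e₂) := by
    obtain ⟨hc, hT⟩ := hfr.of_two_cusps hF4 hl₃ h31 h32 h33
    exact ⟨⟨⟨_, _, hli12, rfl⟩, Or.inr hT⟩, hc, by simp [hcount hl₃, h31, h32, h33]⟩
  have ht₁ : ThetaLineOfType F 2 (lineThrough e₂ e₃) := by
    obtain ⟨hc, hT⟩ := hfr.rotate.of_two_cusps hF4 hl₁ h12' h13' h11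
    exact ⟨⟨⟨_, _, hli23, rfl⟩, Or.inr hT⟩, hc, by simp [hcount hl₁, h12', h13', h11]⟩
  have ht₂ : ThetaLineOfType F 2 (lineThrough e₃ e₁) := by
    obtain ⟨hc, hT⟩ := hfr.rotate.rotate.of_two_cusps hF4 hl₂ h23' h21' h22
    exact ⟨⟨⟨_, _, hli31, rfl⟩, Or.inr hT⟩, hc, by simp [hcount hl₂, h23', h21', h22]⟩
  refine ⟨?_, ?_, ?_, ?_⟩
  · rw [Set.ncard_eq_one]
    refine ⟨_, Set.eq_singleton_iff_unique_mem.mpr ⟨htB, fun S hS => ?_⟩⟩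
    rcases htype 0 S hS with ⟨-, h⟩ | ⟨h, -⟩
    exacts [h, absurd h (by norm_num)]
  · refine Set.eq_empty_of_forall_notMem fun S hS => ?_
    rcases htype 1 S hS with ⟨h, -⟩ | ⟨h, -⟩ <;> norm_num at h
  · rw [Set.ncard_eq_three]
    refine ⟨lineThrough e₁ e₂, lineThrough e₂ e₃, lineThrough e₃ e₁, fun h => ?_, fun h => ?_,
      fun h => ?_, Set.ext fun S => ⟨fun hS => ?_, ?_⟩⟩
    · exact h11 ((hl₁.2 e₁ hn₁).mp (h ▸ (hl₃.2 e₁ hn₁).mpr h31))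
    · exact h33 ((hl₃.2 e₃ hn₃).mp (h ▸ (hl₂.2 e₃ hn₃).mpr h23'))
    · exact h22 ((hl₂.2 e₂ hn₂).mp (h ▸ (hl₁.2 e₂ hn₂).mpr h12'))
    · rcases htype 2 S hS with ⟨h, -⟩ | ⟨-, h⟩
      exacts [absurd h (by norm_num), h]
    · rintro (rfl | rfl | rfl)
      exacts [ht₃, ht₁, ht₂]
  · intro S hS
    rcases htype 2 S hS with ⟨h, -⟩ | ⟨-, rfl | rfl | rfl⟩
    · norm_num at h
    · exact Or.inl ⟨(hl₃.2 _ hn₁).mpr h31, (hl₃.2 _ hn₂).mpr h32⟩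
    · exact Or.inr (Or.inr ⟨(hl₁.2 _ hn₂).mpr h12', (hl₁.2 _ hn₃).mpr h13'⟩)
    · exact Or.inr (Or.inl ⟨(hl₂.2 _ hn₁).mpr h21', (hl₂.2 _ hn₃).mpr h23'⟩)

end
end
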